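/- arXiv:2306.01702 — 2 statements merged into one kernel-verified Lean document; each statement's English description precedes it below -/
import Mathlib

section
/- Let W be a primitive ω-Stone space, P a PO system and 𝒴 a trim P-partition of W. Then the ideal completion id(𝒴) is a rank id(P)-partition of W. Moreover: (1) the clean interior of id(𝒴) equals 𝒴; (2) id(𝒴) regularly extends 𝒴, i.e. 𝒴 regularly refines id(𝒴) via the embedding p ↦ p↓ of P into id(P); and (3) the elements of id(𝒴) are exactly the orbits of W under the group of P-homeomorphisms of W (homeomorphisms of W mapping each Y_p onto itself). -/
open Set Filter Topology

universe u v

/-- A PO system: a set with a transitive antisymmetric relation `<`. -/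
structure POSystem (P : Type u) : Type u where
  lt : P → P → Prop
  lt_trans : ∀ {a b c}, lt a b → lt b c → lt a c
  lt_antisymm : ∀ {a b}, lt a b → lt b a → a = b

namespace POSystem

variable {P : Type*} {Q : Type*}

/-- `a ≤ b` iff `a < b` or `a = b`. -/
def le (S : POSystem P) (a b : P) : Prop := S.lt a b ∨ a = b

theorem le_trans {S : POSystem P} {a b c : P} (h1 : S.le a b) (h2 : S.le b c) :
    S.le a c := by
  rcases h1 with h1 | rfl
  · rcases h2 with h2 | rfl
    · exact Or.inl (S.lt_trans h1 h2)
    · exact Or.inl h1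
  · exact h2

/-- A morphism of PO systems. -/
def IsMorphism (SQ : POSystem Q) (SP : POSystem P) (α : Q → P) : Prop :=
  ∀ q : Q, α '' {r | SQ.lt q r} = {p | SP.lt (α q) p}

/-- An isomorphism of PO systems. -/
def IsIso (SQ : POSystem Q) (SP : POSystem P) (β : Q → P) : Prop :=
  Function.Bijective β ∧ ∀ a b : Q, SQ.lt a b ↔ SP.lt (β a) (β b)

/-- An ideal of a PO system: a nonempty directed lower subset. -/
def IsIdeal (S : POSystem P) (J : Set P) : Prop :=
  J.Nonempty ∧ (∀ x ∈ J, ∀ y : P, S.le y x → y ∈ J) ∧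
    ∀ x ∈ J, ∀ y ∈ J, ∃ z ∈ J, S.le x z ∧ S.le y z

/-- An ideal of a subset `Qs` of a PO system. -/
def IsIdealOf (S : POSystem P) (Qs : Set P) (J : Set P) : Prop :=
  J.Nonempty ∧ J ⊆ Qs ∧ (∀ x ∈ J, ∀ y ∈ Qs, S.le y x → y ∈ J) ∧
    ∀ x ∈ J, ∀ y ∈ J, ∃ z ∈ J, S.le x z ∧ S.le y z

/-- The principal ideal `p↓`. -/
def principalIdeal (S : POSystem P) (p : P) : Set P := {q | S.le q p}

theorem principal_isIdeal (S : POSystem P) (p : P) : IsIdeal S (principalIdeal S p) :=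
  ⟨⟨p, Or.inr rfl⟩, fun _ hx y hy => le_trans hy hx,
    fun _ hx _ hy => ⟨p, Or.inr rfl, hx, hy⟩⟩

/-- `p` is the supremum of the subset `A`. -/
def IsSupOf (S : POSystem P) (p : P) (A : Set P) : Prop :=
  (∀ a ∈ A, S.le a p) ∧ ∀ q : P, (∀ a ∈ A, S.le a q) → S.le p q

/-- `p` is separated in `P` if it is not the supremum of a strictly increasing sequence. -/
def Separated (S : POSystem P) (p : P) : Prop :=
  ¬ ∃ u : ℕ → P, (∀ n, S.lt (u n) (u (n + 1)) ∧ u n ≠ u (n + 1)) ∧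
      IsSupOf S p (Set.range u)

/-- `p` is compact in `P`. -/
def CompactIn (S : POSystem P) (p : P) : Prop :=
  ∀ J : Set P, IsIdeal S J → ∀ s : P, IsSupOf S s J → S.le p s → p ∈ J

/-- The lower closure `N↓` of a subset. -/
def downSet (S : POSystem P) (N : Set P) : Set P := {p | ∃ q ∈ N, S.le p q}

/-- `N` has a finite foundation. -/
def HasFinFoundation (S : POSystem P) (N : Set P) : Prop :=
  ∃ F : Set P, F.Finite ∧ F ⊆ downSet S N ∧ ∀ r ∈ downSet S N, ∃ p ∈ F, S.le p r

def PDelta (S : POSystem P) : Set P := {p | HasFinFoundation S {p}}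

def IsLowerSubset (S : POSystem P) (L : Set P) : Prop :=
  ∀ p ∈ L, ∀ q : P, S.le q p → q ∈ L

/-- Minimal elements of `L`. -/
def minIn (S : POSystem P) (L : Set P) : Set P :=
  {p | p ∈ L ∧ ∀ q ∈ L, S.le q p → q = p}

/-- `L_min^d`: minimal elements of `L` lying in `P^d`. -/
def LminD (S : POSystem P) (L : Set P) : Set P := {p | p ∈ minIn S L ∧ ¬ S.lt p p}

/-- `(P, L, f)` is an extended PO system. -/
def IsExtPO (S : POSystem P) (L : Set P) (f : P → ℕ) : Prop :=
  IsLowerSubset S L ∧ L ⊆ PDelta S ∧ ∀ p ∈ LminD S L, 0 < f p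

/-- The order relation on the ideal completion `id(P)`: ordered by inclusion, with
`id(P)^d` the principal ideals `p↓` for `p ∈ P^d`. -/
def idLt (S : POSystem P) (J K : {J : Set P // IsIdeal S J}) : Prop :=
  (J.1 ⊆ K.1 ∧ J ≠ K) ∨ (J = K ∧ ¬ ∃ p : P, ¬ S.lt p p ∧ J.1 = principalIdeal S p)

/-- The ideal completion `id(P)` of a PO system. -/
def idPO (S : POSystem P) : POSystem {J : Set P // IsIdeal S J} where
  lt := idLt S
  lt_trans := by
    intro a b c h1 h2
    unfold idLt at h1 h2 ⊢
    rcases h1 with ⟨hab, hne⟩ | ⟨heq, h⟩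
    · rcases h2 with ⟨hbc, hne'⟩ | ⟨heq', h'⟩
      · refine Or.inl ⟨hab.trans hbc, fun hac => hne ?_⟩
        exact Subtype.ext (subset_antisymm hab (by rw [hac]; exact hbc))
      · rw [← heq']; exact Or.inl ⟨hab, hne⟩
    · rw [heq]; exact h2
  lt_antisymm := by
    intro a b h1 h2
    unfold idLt at h1 h2
    rcases h1 with ⟨hab, _⟩ | ⟨heq, _⟩
    · rcases h2 with ⟨hba, _⟩ | ⟨heq, _⟩
      · exact Subtype.ext (subset_antisymm hab hba)
      · exact heq.symm
    · exact heq

/-- The restriction of a PO system to a subset. -/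
def restrictPO (S : POSystem P) (T : Set P) : POSystem T where
  lt a b := S.lt a b
  lt_trans := fun h1 h2 => S.lt_trans h1 h2
  lt_antisymm := fun h1 h2 => Subtype.ext (S.lt_antisymm h1 h2)

end POSystem

open POSystem

section Partitions

variable {W : Type*} [TopologicalSpace W] {P : Type*} {Q : Type*}

/-- The derived set (set of limit points) of `A`. -/
def limitPts (A : Set W) : Set W := {x | x ∈ closure (A \ {x})}

/-- The type `T(A)` of a subset `A` with respect to a partition `X`. -/
def ptype (X : P → Set W) (A : Set W) : Set P := {p | (A ∩ X p).Nonempty}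

/-- A `P`-partition of `W`: pairwise disjoint nonempty sets `X p` such that
`(X p)' ∩ X = ⋃_{q < p} X q`. -/
def IsPPartition (S : POSystem P) (X : P → Set W) : Prop :=
  (∀ p, (X p).Nonempty) ∧ (Pairwise fun p q => Disjoint (X p) (X q)) ∧
    ∀ p, limitPts (X p) ∩ (⋃ q, X q) = ⋃ q ∈ {q : P | S.lt q p}, X q

/-- `A` is a `p`-trim set. -/
def IsTrimAt (S : POSystem P) (X : P → Set W) (A : Set W) (p : P) : Prop :=
  IsCompact A ∧ IsOpen A ∧ ptype X A = {q | S.le p q} ∧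
    (¬ S.lt p p → ∃! x, x ∈ A ∩ X p)

/-- `A` is a trim set. -/
def IsTrimSet (S : POSystem P) (X : P → Set W) (A : Set W) : Prop :=
  ∃ p, IsTrimAt S X A p

/-- `P̂`: the set of `p` for which some `p`-trim set exists. -/
def Phat (S : POSystem P) (X : P → Set W) : Set P := {p | ∃ A, IsTrimAt S X A p}

/-- Axiom T1: every point has a neighbourhood base of trim sets. -/
def HasTrimBases (S : POSystem P) (X : P → Set W) : Prop :=
  ∀ w : W, ∀ U ∈ nhds w, ∃ A, IsTrimSet S X A ∧ w ∈ A ∧ A ⊆ U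

/-- Axiom T2 (fullness). -/
def IsFull (S : POSystem P) (X : P → Set W) : Prop :=
  ∀ p ∈ Phat S X, ∀ w : W,
    (∀ U ∈ nhds w, ∃ A, IsTrimAt S X A p ∧ w ∈ A ∧ A ⊆ U) → w ∈ X p

/-- `w` is a clean point. -/
def IsCleanPt (S : POSystem P) (X : P → Set W) (w : W) : Prop :=
  ∃ p, w ∈ X p ∧ ∃ A, IsTrimAt S X A p ∧ w ∈ A

/-- Axiom T3: all points of `X` are clean. -/
def AllClean (S : POSystem P) (X : P → Set W) : Prop :=
  ∀ p : P, ∀ w ∈ X p, ∃ A, IsTrimAt S X A p ∧ w ∈ A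

/-- A trim `P`-partition. -/
def IsTrimPartition (S : POSystem P) (X : P → Set W) : Prop :=
  IsPPartition S X ∧ HasTrimBases S X ∧ IsFull S X ∧ AllClean S X

/-- A complete partition: the blocks cover `W`. -/
def IsCompletePartition (X : P → Set W) : Prop := (⋃ p, X p) = Set.univ

/-- `Y` refines `Z` via `α`. -/
def Refines (Y : Q → Set W) (Z : P → Set W) (α : Q → P) : Prop :=
  ∀ q, Y q ⊆ Z (α q)

/-- `Y` regularly refines `Z` via `α` (`Z` regularly consolidates `Y` via `α`). -/
def RegRefines (SQ : POSystem Q) (SP : POSystem P) (Y : Q → Set W) (Z : P → Set W)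
    (α : Q → P) : Prop :=
  Refines Y Z α ∧ ∀ p ∈ Phat SP Z, ∀ A : Set W, IsTrimAt SP Z A p → p ∈ α '' ptype Y A

/-- A semi-trim partition: T1, T2, and clean points are dense in each `X p`, `p ∈ P̂`. -/
def IsSemiTrim (S : POSystem P) (X : P → Set W) : Prop :=
  IsPPartition S X ∧ HasTrimBases S X ∧ IsFull S X ∧
    ∀ p ∈ Phat S X, X p ⊆ closure {w | w ∈ X p ∧ ∃ A, IsTrimAt S X A p ∧ w ∈ A}

/-- A strongly semi-trim partition: T1, T2, and all points of `X p` are clean, `p ∈ P̂`. -/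
def IsStronglySemiTrim (S : POSystem P) (X : P → Set W) : Prop :=
  IsPPartition S X ∧ HasTrimBases S X ∧ IsFull S X ∧
    ∀ p ∈ Phat S X, ∀ w ∈ X p, ∃ A, IsTrimAt S X A p ∧ w ∈ A

/-- The labels of a sequence are pairwise strictly incomparable or strictly increasing. -/
def PairwiseIncompOrStrictIncr (S : POSystem P) (τ : ℕ → P) : Prop :=
  (∀ j k, j ≠ k → ¬ S.le (τ j) (τ k)) ∨ (∀ j k, j < k → S.lt (τ j) (τ k) ∧ τ j ≠ τ k)

/-- A rank `P`-partition: a complete `P`-partition satisfying RP1 and RP2. -/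
def IsRankPartition (S : POSystem P) (X : P → Set W) : Prop :=
  IsPPartition S X ∧ IsCompletePartition X ∧
    (∀ q : P, Separated S q → ∀ (x : W) (u : ℕ → W) (τx : P) (τu : ℕ → P),
      x ∈ X τx → (∀ k, u k ∈ X (τu k)) →
      Filter.Tendsto u Filter.atTop (nhds x) → (∀ k, u k ≠ x) →
      S.le q τx → PairwiseIncompOrStrictIncr S τu →
      ∀ᶠ k in Filter.atTop, S.le q (τu k)) ∧
    (∀ (x : W) (τx : P), x ∈ X τx → ¬ Separated S τx →
      ∃ u : ℕ → W, Filter.Tendsto u Filter.atTop (nhds x) ∧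
        ∀ k, ∃ q, u k ∈ X q ∧ S.lt q τx ∧ q ≠ τx)

/-- `I_w`: the set of types of trim neighbourhoods of `w`. -/
def Iw (S : POSystem P) (X : P → Set W) (w : W) : Set P :=
  {p | ∃ A : Set W, IsTrimAt S X A p ∧ w ∈ A}

/-- A trim `(P, L, f)`-partition. -/
def IsTrimPLF (S : POSystem P) (L : Set P) (f : P → ℕ) (Z : P → Set W) : Prop :=
  IsTrimPartition S Z ∧ (∀ p, IsCompact (closure (Z p)) ↔ p ∈ L) ∧
    ∀ p ∈ LminD S L, Nat.card (Z p) = f p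

/-- A bounded trim `(P, L, f)`-partition. -/
def IsBoundedTrimPLF (S : POSystem P) (L : Set P) (f : P → ℕ) (Z : P → Set W) : Prop :=
  IsTrimPLF S L f Z ∧ IsCompact (closure (⋃ p ∈ L, Z p))

end Partitions

section Primitive

variable {W : Type*} [TopologicalSpace W]

/-- The ideal `(A)` of compact open subsets of `A`. -/
def coIdeal (A : Set W) : Set (Set W) := {C | IsCompact C ∧ IsOpen C ∧ C ⊆ A}

/-- `(A) ≅ (B)` as Boolean rings (equivalently, as posets). -/
def IdealIso (A B : Set W) : Prop := Nonempty (↥(coIdeal A) ≃o ↥(coIdeal B))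

/-- `(A) × (B) ≅ (A)`. -/
def ProdIdealIso (A B : Set W) : Prop :=
  Nonempty ((↥(coIdeal A) × ↥(coIdeal B)) ≃o ↥(coIdeal A))

/-- A compact open `A` is pseudo-indecomposable (PI). -/
def IsPISet (A : Set W) : Prop :=
  IsCompact A ∧ IsOpen A ∧ ∀ B : Set W, IsCompact B → IsOpen B → B ⊆ A →
    IdealIso B A ∨ IdealIso (A \ B) A

/-- `W` is primitive: every compact open set is a finite disjoint union of PI sets. -/
def PrimitiveSpace (W : Type*) [TopologicalSpace W] : Prop :=
  ∀ A : Set W, IsCompact A → IsOpen A →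
    ∃ (n : ℕ) (F : Fin n → Set W), (∀ i, IsPISet (F i)) ∧
      (Pairwise fun i j => Disjoint (F i) (F j)) ∧ A = ⋃ i, F i

/-- The setoid of PI compact opens up to isomorphism of their ideals. -/
def piIsoSetoid (W : Type*) [TopologicalSpace W] : Setoid {A : Set W // IsPISet A} where
  r A B := IdealIso A.1 B.1
  iseqv := ⟨fun _ => ⟨OrderIso.refl _⟩,
    fun h => h.elim fun e => ⟨e.symm⟩,
    fun h1 h2 => h1.elim fun e => h2.elim fun f => ⟨e.trans f⟩⟩

/-- The underlying set of the structure diagram `𝒮(W)`: isomorphism classes of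
PI compact open subsets of `W`. -/
def SDiagram (W : Type*) [TopologicalSpace W] : Type _ := Quotient (piIsoSetoid W)

/-- The relation on `𝒮(W)`: `[A] < [B]` iff `(A) × (B) ≅ (A)`. -/
def SDiagramLt {W : Type*} [TopologicalSpace W] (x y : SDiagram W) : Prop :=
  ∃ A B : {A : Set W // IsPISet A}, x = Quotient.mk (piIsoSetoid W) A ∧
    y = Quotient.mk (piIsoSetoid W) B ∧ ProdIdealIso A.1 B.1

/-- The blocks of the canonical partition `𝒳(W)`: points having a neighbourhood base
of compact open sets of class `p`. -/
def canonicalBlock {W : Type*} [TopologicalSpace W] (p : SDiagram W) : Set W :=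
  {w | ∀ U ∈ nhds w, ∃ A : {A : Set W // IsPISet A},
      Quotient.mk (piIsoSetoid W) A = p ∧ w ∈ A.1 ∧ A.1 ⊆ U}

/-- The setoid of points of `W` under the homeomorphism group. -/
def homeoSetoid (W : Type*) [TopologicalSpace W] : Setoid W where
  r w x := ∃ h : W ≃ₜ W, h w = x
  iseqv := ⟨fun w => ⟨Homeomorph.refl W, rfl⟩,
    fun h => h.elim fun e he => ⟨e.symm, by rw [← he, Homeomorph.symm_apply_apply]⟩,
    fun h1 h2 => h1.elim fun e he => h2.elim fun f hf =>
      ⟨e.trans f, by rw [Homeomorph.trans_apply, he, hf]⟩⟩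

end Primitive

section Helpers

variable {W : Type*} [TopologicalSpace W] {P : Type*} {S : POSystem P} {Y : P → Set W}

namespace ICP

theorem le_antisymm' {a b : P} (h1 : S.le a b) (h2 : S.le b a) : a = b := by
  rcases h1 with h1 | h1
  · rcases h2 with h2 | h2
    · exact S.lt_antisymm h1 h2
    · exact h2.symm
  · exact h1

theorem mem_type {A : Set W} {p q : P} (hA : IsTrimAt S Y A p) {y : W} (hy : y ∈ A)
    (hq : y ∈ Y q) : S.le p q := by
  have : q ∈ ptype Y A := ⟨y, hy, hq⟩
  rw [hA.2.2.1] at this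
  exact this

theorem exists_pt {A : Set W} {p q : P} (hA : IsTrimAt S Y A p) (h : S.le p q) :
    ∃ y ∈ A, y ∈ Y q := by
  have : q ∈ ptype Y A := by rw [hA.2.2.1]; exact h
  obtain ⟨y, h1, h2⟩ := this
  exact ⟨y, h1, h2⟩

theorem exists_pt_self {A : Set W} {p : P} (hA : IsTrimAt S Y A p) : ∃ y ∈ A, y ∈ Y p :=
  exists_pt hA (Or.inr rfl)

theorem type_mono {A B : Set W} {p q : P} (hA : IsTrimAt S Y A p) (hB : IsTrimAt S Y B q)
    (h : A ⊆ B) : S.le q p := by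
  obtain ⟨y, h1, h2⟩ := exists_pt_self hA
  exact mem_type hB (h h1) h2

theorem type_unique {A : Set W} {p q : P} (hA : IsTrimAt S Y A p) (hB : IsTrimAt S Y A q) :
    p = q := le_antisymm' (type_mono hB hA subset_rfl) (type_mono hA hB subset_rfl)

theorem limit (hY : IsTrimPartition S Y) {p q : P} (h : S.lt p q) {y : W} (hy : y ∈ Y p)
    {U : Set W} (hU : IsOpen U) (hyU : y ∈ U) : ∃ z ∈ U, z ∈ Y q ∧ z ≠ y := by
  have h1 : y ∈ limitPts (Y q) ∩ ⋃ q, Y q := by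
    rw [hY.1.2.2 q]
    simp only [mem_iUnion]
    exact ⟨p, h, hy⟩
  obtain ⟨z, hz, hz2, hz3⟩ := mem_closure_iff.1 h1.1 U hU hyU
  exact ⟨z, hz, hz2, hz3⟩

theorem rem (hY : IsTrimPartition S Y) {D D' : Set W} {p : P} (hD : IsTrimAt S Y D p)
    (hc : IsCompact D') (ho : IsOpen D') (hs : D' ⊆ D) {y : W} (hy : y ∈ D') (hyp : y ∈ Y p) :
    IsTrimAt S Y D' p := by
  refine ⟨hc, ho, ?_, ?_⟩
  · ext q
    constructor
    · rintro ⟨z, hz, hz2⟩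
      exact mem_type hD (hs hz) hz2
    · rintro (h | h)
      · obtain ⟨z, hz, hz2, -⟩ := limit hY h hyp ho hy
        exact ⟨z, hz, hz2⟩
      · subst h; exact ⟨y, hy, hyp⟩
  · intro h
    refine ⟨y, ⟨hy, hyp⟩, fun z hz => ?_⟩
    exact (hD.2.2.2 h).unique ⟨hs hz.1, hz.2⟩ ⟨hs hy, hyp⟩

theorem union_trim {A E : Set W} {p q : P} (hE : IsTrimAt S Y E q)
    (hA : IsTrimAt S Y A p) (hqp : S.le q p)
    (h : ¬ S.lt q q → ∀ z ∈ A, z ∈ Y q → z ∈ E) : IsTrimAt S Y (E ∪ A) q := by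
  refine ⟨hE.1.union hA.1, hE.2.1.union hA.2.1, ?_, ?_⟩
  · ext r
    constructor
    · rintro ⟨z, hz | hz, hz2⟩
      · exact mem_type hE hz hz2
      · exact le_trans hqp (mem_type hA hz hz2)
    · intro hr
      obtain ⟨z, hz, hz2⟩ := exists_pt hE hr
      exact ⟨z, Or.inl hz, hz2⟩
  · intro hq
    obtain ⟨y, hy, hy2⟩ := exists_pt_self hE
    refine ⟨y, ⟨Or.inl hy, hy2⟩, ?_⟩
    rintro z ⟨hz | hz, hz2⟩
    · exact (hE.2.2.2 hq).unique ⟨hz, hz2⟩ ⟨hy, hy2⟩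
    · exact (hE.2.2.2 hq).unique ⟨h hq z hz hz2, hz2⟩ ⟨hy, hy2⟩

theorem nbhd (hY : IsTrimPartition S Y) {p : P} {y : W} (hy : y ∈ Y p) {U : Set W}
    (hU : IsOpen U) (hyU : y ∈ U) : ∃ F, IsTrimAt S Y F p ∧ y ∈ F ∧ F ⊆ U := by
  obtain ⟨B, hB, hyB⟩ := hY.2.2.2 p y hy
  obtain ⟨A, ⟨q, hA⟩, hyA, hAU⟩ := hY.2.1 y (U ∩ B) ((hU.inter hB.2.1).mem_nhds ⟨hyU, hyB⟩)
  exact ⟨A, rem hY hB hA.1 hA.2.1 (fun a ha => (hAU ha).2) hyA hy, hyA, fun a ha => (hAU ha).1⟩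


theorem Iw_lower (hY : IsTrimPartition S Y) {w : W} {p q : P} (hp : p ∈ Iw S Y w)
    (h : S.le q p) : q ∈ Iw S Y w := by
  obtain ⟨A, hA, hw⟩ := hp
  by_cases hqp : q = p
  · subst hqp; exact ⟨A, hA, hw⟩
  obtain ⟨y, hy⟩ := hY.1.1 q
  obtain ⟨B, hB, hyB⟩ := hY.2.2.2 q y hy
  refine ⟨B ∪ A, union_trim hB hA h ?_, Or.inr hw⟩
  intro _ z hz hzq
  exact absurd (le_antisymm' h (mem_type hA hz hzq)) hqp

theorem Iw_ideal (hY : IsTrimPartition S Y) (w : W) : IsIdeal S (Iw S Y w) := by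
  refine ⟨?_, fun p hp q hq => Iw_lower hY hp hq, ?_⟩
  · obtain ⟨A, ⟨p, hA⟩, hw, -⟩ := hY.2.1 w univ univ_mem
    exact ⟨p, A, hA, hw⟩
  · rintro p ⟨A, hA, hwA⟩ q ⟨B, hB, hwB⟩
    obtain ⟨C, ⟨r, hC⟩, hw, hs⟩ := hY.2.1 w (A ∩ B) ((hA.2.1.inter hB.2.1).mem_nhds ⟨hwA, hwB⟩)
    exact ⟨r, ⟨C, hC, hw⟩, type_mono hC hA (hs.trans inter_subset_left),
      type_mono hC hB (hs.trans inter_subset_right)⟩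

theorem principal_inj {p q : P} (h : principalIdeal S p = principalIdeal S q) : p = q := by
  have h1 : p ∈ principalIdeal S q := by rw [← h]; exact Or.inr rfl
  have h2 : q ∈ principalIdeal S p := by rw [h]; exact Or.inr rfl
  exact le_antisymm' h1 h2

theorem Iw_principal_iff (hY : IsTrimPartition S Y) {p : P} {w : W} :
    Iw S Y w = principalIdeal S p ↔ w ∈ Y p := by
  constructor
  · intro h
    have hp : p ∈ Iw S Y w := by rw [h]; exact Or.inr rfl
    obtain ⟨B, hB, hwB⟩ := hp
    refine hY.2.2.1 p ⟨B, hB⟩ w fun U hU => ?_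
    obtain ⟨A, ⟨q, hA⟩, hwA, hAU⟩ := hY.2.1 w (U ∩ B) (inter_mem hU (hB.2.1.mem_nhds hwB))
    have hq : q ∈ principalIdeal S p := by rw [← h]; exact ⟨A, hA, hwA⟩
    have : q = p := le_antisymm' hq (type_mono hA hB (hAU.trans inter_subset_right))
    subst this
    exact ⟨A, hA, hwA, hAU.trans inter_subset_left⟩
  · intro hy
    ext q
    constructor
    · rintro ⟨A, hA, hw⟩
      exact mem_type hA hw hy
    · intro hq
      exact Iw_lower hY (hY.2.2.2 p w hy) hq

theorem shrink (hY : IsTrimPartition S Y) {x : W} {r : P} (hr : r ∈ Iw S Y x) {U : Set W}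
    (hU : IsOpen U) (hx : x ∈ U) {z : W} (hz : z ∈ U) (hzr : z ∈ Y r) :
    ∃ F, IsTrimAt S Y F r ∧ x ∈ F ∧ F ⊆ U := by
  obtain ⟨B, hB, hxB⟩ := hr
  obtain ⟨A, ⟨t, hA⟩, hxA, hAU⟩ := hY.2.1 x (U ∩ B) ((hU.inter hB.2.1).mem_nhds ⟨hx, hxB⟩)
  have hrt := type_mono hA hB (hAU.trans inter_subset_right)
  by_cases h : r = t
  · subst h; exact ⟨A, hA, hxA, hAU.trans inter_subset_left⟩
  · obtain ⟨F, hF, -, hFU⟩ := nbhd hY hzr hU hz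
    refine ⟨F ∪ A, union_trim hF hA hrt ?_, Or.inr hxA,
      union_subset hFU (hAU.trans inter_subset_left)⟩
    intro _ u hu hur
    exact absurd (le_antisymm' hrt (mem_type hA hu hur)) h

variable [T2Space W]

theorem diff_trim (hY : IsTrimPartition S Y) {D F : Set W} {p r : P} (hD : IsTrimAt S Y D p)
    (hF : IsTrimAt S Y F r) {y : W} (hy : y ∈ D) (hyp : y ∈ Y p) (hyF : y ∉ F) :
    IsTrimAt S Y (D \ F) p :=
  rem hY hD (hD.1.diff hF.2.1) (hD.2.1.sdiff hF.1.isClosed) sdiff_subset ⟨hy, hyF⟩ hyp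

theorem carve (hY : IsTrimPartition S Y) {D : Set W} {p r : P} (hD : IsTrimAt S Y D p)
    (hpr : S.lt p r) (x : W) (b : Prop) (hb : b → x ∈ D ∧ r ∈ Iw S Y x) :
    ∃ F, IsTrimAt S Y F r ∧ F ⊆ D ∧ IsTrimAt S Y (D \ F) p ∧ (x ∈ F ↔ b) := by
  by_cases hb' : b
  · obtain ⟨hx, hr⟩ := hb hb'
    have h1 : ∃ y ∈ D, y ∈ Y p ∧ y ≠ x := by
      obtain ⟨y, hy, hyp⟩ := exists_pt_self hD
      by_cases h : y = x
      · subst h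
        rw [(Iw_principal_iff hY).2 hyp] at hr
        have : p = r := le_antisymm' (Or.inl hpr) hr
        subst this
        exact limit hY hpr hyp hD.2.1 hx
      · exact ⟨y, hy, hyp, h⟩
    obtain ⟨y, hy, hyp, hyx⟩ := h1
    obtain ⟨z, hz, hzr, hzy⟩ := limit hY hpr hyp hD.2.1 hy
    obtain ⟨F, hF, hxF, hFU⟩ := shrink hY hr (U := D \ {y}) (hD.2.1.sdiff isClosed_singleton)
      ⟨hx, fun h => hyx h.symm⟩ (z := z) ⟨hz, hzy⟩ hzr
    exact ⟨F, hF, hFU.trans sdiff_subset, diff_trim hY hD hF hy hyp fun h => (hFU h).2 rfl,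
      iff_of_true hxF hb'⟩
  · obtain ⟨y, hy, hyp⟩ := exists_pt_self hD
    have h1 : ∃ z ∈ D, z ∈ Y r ∧ z ≠ y ∧ z ≠ x := by
      by_cases h : y = x
      · subst h
        obtain ⟨z, hz, hzr, hzy⟩ := limit hY hpr hyp hD.2.1 hy
        exact ⟨z, hz, hzr, hzy, hzy⟩
      · obtain ⟨z, hz, hzr, hzy⟩ := limit hY hpr hyp
          (hD.2.1.sdiff (isClosed_singleton (x := x))) ⟨hy, h⟩
        exact ⟨z, hz.1, hzr, hzy, hz.2⟩
    obtain ⟨z, hz, hzr, hzy, hzx⟩ := h1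
    obtain ⟨F, hF, -, hFU⟩ := nbhd hY hzr (U := (D \ {y}) \ {x})
      ((hD.2.1.sdiff isClosed_singleton).sdiff isClosed_singleton) ⟨⟨hz, hzy⟩, hzx⟩
    exact ⟨F, hF, fun a ha => (hFU ha).1.1, diff_trim hY hD hF hy hyp fun h => (hFU h).1.2 rfl,
      iff_of_false (fun h => (hFU h).2 rfl) hb'⟩

/-- decomposition into finitely many disjoint trim sets decided by `G` -/
def Dec (S : POSystem P) (Y : P → Set W) (G C : Set W) (E : Finset (Set W)) : Prop :=
  (∀ A ∈ E, IsTrimSet S Y A ∧ (A ⊆ G ∨ A ⊆ Gᶜ)) ∧ (E : Set (Set W)).PairwiseDisjoint id ∧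
    ⋃₀ (E : Set (Set W)) = C

open Classical in
theorem dec_add (hY : IsTrimPartition S Y) {G C A : Set W} {E : Finset (Set W)}
    (hE : Dec S Y G C E) (hA : IsTrimSet S Y A) (hAG : A ⊆ G ∨ A ⊆ Gᶜ) :
    ∃ E', Dec S Y G (A ∪ C) E' := by
  obtain ⟨h1, h2, h3⟩ := hE
  obtain ⟨p, hA⟩ := hA
  obtain ⟨y, hy, hyp⟩ := exists_pt_self hA
  have hCc : IsCompact C := by
    rw [← h3]
    exact E.finite_toSet.isCompact_sUnion fun B hB => by
      obtain ⟨⟨q, hq⟩, -⟩ := h1 B hB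
      exact hq.1
  have hCo : IsOpen C := by
    rw [← h3]
    exact isOpen_sUnion fun B hB => by
      obtain ⟨⟨q, hq⟩, -⟩ := h1 B hB
      exact hq.2.1
  by_cases hyC : y ∈ C
  · rw [← h3] at hyC
    obtain ⟨B, hB, hyB⟩ := hyC
    have hB' : B ∈ E := hB
    obtain ⟨⟨q, hq⟩, hBG⟩ := h1 B hB
    have hBC : B ⊆ C := by rw [← h3]; exact subset_sUnion_of_mem hB
    have hqp := mem_type hq hyB hyp
    have hu : IsTrimAt S Y (B ∪ A) q := by
      refine union_trim hq hA hqp fun hqq z hz hzq => ?_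
      have : q = p := le_antisymm' hqp (mem_type hA hz hzq)
      subst this
      rwa [(hA.2.2.2 hqq).unique ⟨hz, hzq⟩ ⟨hy, hyp⟩]
    obtain ⟨v, hv, hvq⟩ := exists_pt_self hq
    have hu' : IsTrimAt S Y (B ∪ (A \ C)) q :=
      rem hY hu (hq.1.union (hA.1.diff hCo)) (hq.2.1.union (hA.2.1.sdiff hCc.isClosed))
        (union_subset_union_right _ sdiff_subset) (Or.inl hv) hvq
    refine ⟨insert (B ∪ (A \ C)) (E.erase B), ?_, ?_, ?_⟩
    · intro D hD
      rw [Finset.mem_insert] at hD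
      rcases hD with rfl | hD
      · refine ⟨⟨q, hu'⟩, ?_⟩
        rcases hBG with hBG | hBG
        · rcases hAG with hAG | hAG
          · exact Or.inl (union_subset hBG (sdiff_subset.trans hAG))
          · exact absurd (hBG hyB) (hAG hy)
        · rcases hAG with hAG | hAG
          · exact absurd (hAG hy) (hBG hyB)
          · exact Or.inr (union_subset hBG (sdiff_subset.trans hAG))
      · exact h1 D (Finset.mem_of_mem_erase hD)
    · rw [Finset.coe_insert]
      refine (h2.subset (by intro D hD; exact Finset.mem_of_mem_erase hD)).insert ?_
      intro D hD _
      have hD1 : D ∈ E := Finset.mem_of_mem_erase hD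
      have hD2 : D ≠ B := Finset.ne_of_mem_erase hD
      have hDC : D ⊆ C := by rw [← h3]; exact subset_sUnion_of_mem hD1
      refine Disjoint.union_left (h2 hB hD1 hD2.symm) ?_
      exact disjoint_sdiff_left.mono_right hDC
    · ext z
      simp only [mem_sUnion, Finset.coe_insert, mem_insert_iff, Finset.mem_coe,
        Finset.mem_erase, ← h3]
      constructor
      · rintro ⟨D, rfl | ⟨hD1, hD2⟩, hz⟩
        · rcases hz with hz | hz
          · exact Or.inr ⟨B, hB', hz⟩
          · exact Or.inl hz.1
        · exact Or.inr ⟨D, hD2, hz⟩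
      · intro h
        by_cases hzC : z ∈ C
        · rw [← h3] at hzC
          obtain ⟨D, hD, hzD⟩ := hzC
          by_cases hDB : D = B
          · subst hDB
            exact ⟨_, Or.inl rfl, Or.inl hzD⟩
          · exact ⟨D, Or.inr ⟨hDB, hD⟩, hzD⟩
        · refine ⟨_, Or.inl rfl, Or.inr ?_⟩
          rcases h with h | h
          · exact ⟨h, by simpa [← h3] using hzC⟩
          · exact absurd (by simpa [← h3] using h) hzC
  · have hA' : IsTrimAt S Y (A \ C) p :=
      rem hY hA (hA.1.diff hCo) (hA.2.1.sdiff hCc.isClosed) sdiff_subset ⟨hy, hyC⟩ hyp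
    refine ⟨insert (A \ C) E, ?_, ?_, ?_⟩
    · intro D hD
      rw [Finset.mem_insert] at hD
      rcases hD with rfl | hD
      · exact ⟨⟨p, hA'⟩, hAG.imp (sdiff_subset.trans ·) (sdiff_subset.trans ·)⟩
      · exact h1 D hD
    · rw [Finset.coe_insert]
      refine h2.insert ?_
      intro D hD1 _
      have hDC : D ⊆ C := by rw [← h3]; exact subset_sUnion_of_mem hD1
      exact disjoint_sdiff_left.mono_right hDC
    · rw [Finset.coe_insert, sUnion_insert, h3, sdiff_union_self]

theorem dec_exists (hY : IsTrimPartition S Y) {G C : Set W} (hG : IsClopen G)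
    (hC : IsCompact C) (hCo : IsOpen C) : ∃ E, Dec S Y G C E := by
  have h : ∀ c ∈ C, ∃ A, (IsTrimSet S Y A ∧ (A ⊆ G ∨ A ⊆ Gᶜ)) ∧ c ∈ A ∧ A ⊆ C := by
    intro c hc
    by_cases hcG : c ∈ G
    · obtain ⟨A, h1, h2, h3⟩ := hY.2.1 c (C ∩ G) ((hCo.inter hG.isOpen).mem_nhds ⟨hc, hcG⟩)
      exact ⟨A, ⟨h1, Or.inl (h3.trans inter_subset_right)⟩, h2, h3.trans inter_subset_left⟩
    · obtain ⟨A, h1, h2, h3⟩ := hY.2.1 c (C ∩ Gᶜ)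
        ((hCo.inter hG.compl.isOpen).mem_nhds ⟨hc, hcG⟩)
      exact ⟨A, ⟨h1, Or.inr (h3.trans inter_subset_right)⟩, h2, h3.trans inter_subset_left⟩
  choose! A hA1 hA2 hA3 using h
  obtain ⟨t, ht, hCt⟩ := hC.elim_nhds_subcover A fun c hc => by
    obtain ⟨⟨⟨p, hp⟩, -⟩, -⟩ := And.intro (hA1 c hc) trivial
    exact hp.2.1.mem_nhds (hA2 c hc)
  have key : ∀ s : Finset W, (∀ x ∈ s, x ∈ C) → ∃ E, Dec S Y G (⋃ x ∈ s, A x) E := by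
    intro s
    classical
    induction s using Finset.induction_on with
    | empty => intro _; exact ⟨∅, by simp [Dec]⟩
    | insert a s _ ih =>
      intro hs
      obtain ⟨E, hE⟩ := ih fun x hx => hs x (Finset.mem_insert_of_mem hx)
      have ha := hA1 a (hs a (Finset.mem_insert_self _ _))
      rw [Finset.set_biUnion_insert]
      exact dec_add hY hE ha.1 ha.2
  have : C = ⋃ x ∈ t, A x :=
    subset_antisymm hCt (iUnion₂_subset fun x hx => hA3 x (ht x hx))
  rw [this]
  exact key t ht


theorem base_exists [SecondCountableTopology W] [Nonempty W] (hY : IsTrimPartition S Y) :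
    ∃ G : ℕ → Set W, (∀ n, IsTrimSet S Y (G n)) ∧
      ∀ x U, IsOpen U → x ∈ U → ∃ n, x ∈ G n ∧ G n ⊆ U := by
  have hb : TopologicalSpace.IsTopologicalBasis {A : Set W | IsTrimSet S Y A} := by
    apply TopologicalSpace.isTopologicalBasis_of_isOpen_of_nhds
    · rintro A ⟨p, hp⟩; exact hp.2.1
    · intro x U hx hU
      exact hY.2.1 x U (hU.mem_nhds hx)
  obtain ⟨s, hs, hc, hsb⟩ := hb.exists_countable
  have hne : s.Nonempty := by
    obtain ⟨w⟩ := ‹Nonempty W›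
    obtain ⟨A, hA, -⟩ := hsb.exists_subset_of_mem_open (mem_univ w) isOpen_univ
    exact ⟨A, hA⟩
  obtain ⟨G, rfl⟩ := hc.exists_eq_range hne
  refine ⟨G, fun n => hs ⟨n, rfl⟩, fun x U hU hx => ?_⟩
  obtain ⟨_, ⟨n, rfl⟩, h1, h2⟩ := hsb.exists_subset_of_mem_open hx hU
  exact ⟨n, h1, h2⟩

theorem countable_P [SecondCountableTopology W] (hY : IsTrimPartition S Y) : Countable P := by
  rcases isEmpty_or_nonempty P with hP | ⟨⟨p0⟩⟩
  · infer_instance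
  have : Nonempty W := ⟨(hY.1.1 p0).some⟩
  obtain ⟨G, hG, hb⟩ := base_exists hY
  have h : ∀ p, ∃ n, IsTrimAt S Y (G n) p := by
    intro p
    obtain ⟨y, hy⟩ := hY.1.1 p
    obtain ⟨A, hA, hyA⟩ := hY.2.2.2 p y hy
    obtain ⟨n, h1, h2⟩ := hb y A hA.2.1 hyA
    obtain ⟨q, hq⟩ := hG n
    exact ⟨n, rem hY hA hq.1 hq.2.1 h2 h1 hy⟩
  choose f hf using h
  refine Function.Injective.countable (f := f) fun p q hpq => ?_
  have h1 := hf p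
  rw [hpq] at h1
  exact type_unique h1 (hf q)

theorem exists_Iw [SecondCountableTopology W] (hY : IsTrimPartition S Y) {A : Set W} {p : P}
    (hA : IsTrimAt S Y A p) {J : Set P} (hJ : IsIdeal S J) (hp : p ∈ J) :
    ∃ x ∈ A, Iw S Y x = J := by
  have := countable_P hY
  have : Nonempty W := ⟨(hY.1.1 p).some⟩
  obtain ⟨G, hG, hb⟩ := base_exists hY
  obtain ⟨e, he⟩ := (Set.to_countable J).exists_eq_range hJ.1
  have he' : ∀ n, e n ∈ J := fun n => by rw [he]; exact ⟨n, rfl⟩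
  let T := {a : Set W × P // IsTrimAt S Y a.1 a.2 ∧ a.2 ∈ J}
  have step : ∀ (n : ℕ) (a : T), ∃ b : T, b.1.1 ⊆ a.1.1 ∧ S.le (e n) b.1.2 ∧
      (b.1.1 ⊆ G n ∨ b.1.1 ⊆ (G n)ᶜ) := by
    rintro n ⟨⟨A, p⟩, hA, hp⟩
    obtain ⟨q, hq, hpq, heq⟩ := hJ.2.2 p hp (e n) (he' n)
    obtain ⟨y, hy, hyq⟩ := exists_pt hA hpq
    obtain ⟨g, hg⟩ := hG n
    by_cases hyG : y ∈ G n
    · obtain ⟨F, hF, -, hFU⟩ := nbhd hY hyq (hA.2.1.inter hg.2.1) ⟨hy, hyG⟩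
      exact ⟨⟨(F, q), hF, hq⟩, hFU.trans inter_subset_left, heq,
        Or.inl (hFU.trans inter_subset_right)⟩
    · obtain ⟨F, hF, -, hFU⟩ := nbhd hY hyq (hA.2.1.inter hg.1.isClosed.isOpen_compl) ⟨hy, hyG⟩
      exact ⟨⟨(F, q), hF, hq⟩, hFU.trans inter_subset_left, heq,
        Or.inr (hFU.trans inter_subset_right)⟩
  choose f hf1 hf2 hf3 using step
  let c : ℕ → T := fun n => Nat.rec ⟨(A, p), hA, hp⟩ (fun n a => f n a) n
  have hc : ∀ n, c (n + 1) = f n (c n) := fun n => rfl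
  obtain ⟨x, hx⟩ := IsCompact.nonempty_iInter_of_sequence_nonempty_isCompact_isClosed
    (fun n => (c n).1.1) (fun n => by simp only [hc]; exact hf1 n (c n))
    (fun n => by
      obtain ⟨y, hy, -⟩ := exists_pt_self (c n).2.1
      exact ⟨y, hy⟩) (c 0).2.1.1 (fun n => (c n).2.1.1.isClosed)
  rw [mem_iInter] at hx
  refine ⟨x, hx 0, ?_⟩
  ext r
  constructor
  · rintro ⟨B, hB, hxB⟩
    obtain ⟨n, h1, h2⟩ := hb x B hB.2.1 hxB
    have h3 : (c (n + 1)).1.1 ⊆ B := by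
      rcases hf3 n (c n) with h | h
      · exact h.trans h2
      · exact absurd h1 (h (hx (n + 1)))
    exact hJ.2.1 _ (c (n + 1)).2.2 r (type_mono (c (n + 1)).2.1 hB h3)
  · intro hr
    rw [he] at hr
    obtain ⟨n, rfl⟩ := hr
    exact Iw_lower hY ⟨_, (c (n + 1)).2.1, hx (n + 1)⟩ (hf2 n (c n))

/-- finite disjoint unions of sets satisfying `Q` -/
inductive Spl (Q : Set W → Prop) : Set W → Prop
  | base (E : Set W) : Q E → Spl Q E
  | union (E F : Set W) : Spl Q E → Spl Q F → Disjoint E F → Spl Q (E ∪ F)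

theorem Spl.fn {Q : Set W → Prop} {E : Set W} (h : Spl Q E) :
    ∃ s : W → Set W, ∀ a ∈ E, a ∈ s a ∧ s a ⊆ E ∧ Q (s a) ∧ ∀ b ∈ s a, s b = s a := by
  classical
  induction h with
  | base E hE => exact ⟨fun _ => E, fun a ha => ⟨ha, subset_rfl, hE, fun _ _ => rfl⟩⟩
  | union E F _ _ hd ih1 ih2 =>
    obtain ⟨s, hs⟩ := ih1
    obtain ⟨t, ht⟩ := ih2
    refine ⟨fun a => if a ∈ E then s a else t a, fun a ha => ?_⟩
    by_cases haE : a ∈ E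
    · obtain ⟨h1, h2, h3, h4⟩ := hs a haE
      simp only [haE, if_true]
      refine ⟨h1, h2.trans subset_union_left, h3, fun b hb => ?_⟩
      rw [if_pos (h2 hb)]
      exact h4 b hb
    · have haF : a ∈ F := ha.resolve_left haE
      obtain ⟨h1, h2, h3, h4⟩ := ht a haF
      simp only [haE, if_false]
      refine ⟨h1, h2.trans subset_union_right, h3, fun b hb => ?_⟩
      rw [if_neg fun h => disjoint_left.1 hd h (h2 hb)]
      exact h4 b hb

def Bal (S : POSystem P) (Y : P → Set W) (K : Bool → Set W) (x : Bool → W) (E : Set W) : Prop :=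
  E ⊆ K true ∪ K false ∧ ∃ p, ∀ i, IsTrimAt S Y (E ∩ K i) p ∧ (x i ∈ E → x (!i) ∈ E)

def BalDec (S : POSystem P) (Y : P → Set W) (K : Bool → Set W) (x : Bool → W) (G : Set W)
    (i : Bool) (E : Set W) : Prop :=
  Bal S Y K x E ∧ (E ∩ K i ⊆ G ∨ E ∩ K i ⊆ Gᶜ)

theorem mkBal {K : Bool → Set W} {x : Bool → W} (hK : ∀ i, Disjoint (K i) (K !i))
    (hx : ∀ i, x i ∈ K i) (i : Bool) {C D : Set W} {p : P} (hC : IsTrimAt S Y C p)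
    (hD : IsTrimAt S Y D p) (hCK : C ⊆ K i) (hDK : D ⊆ K !i) (h : x i ∈ C ↔ x (!i) ∈ D) :
    Bal S Y K x (C ∪ D) ∧ (C ∪ D) ∩ K i = C := by
  have e1 : (C ∪ D) ∩ K i = C := by
    ext z
    constructor
    · rintro ⟨hz | hz, hzK⟩
      · exact hz
      · exact absurd (hDK hz) (disjoint_left.1 (hK i) hzK)
    · intro hz; exact ⟨Or.inl hz, hCK hz⟩
  have e2 : (C ∪ D) ∩ K (!i) = D := by
    ext z
    constructor
    · rintro ⟨hz | hz, hzK⟩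
      · exact absurd hzK (disjoint_left.1 (hK i) (hCK hz))
      · exact hz
    · intro hz; exact ⟨Or.inr hz, hDK hz⟩
  have f1 : x i ∈ C ∪ D ↔ x i ∈ C := by
    rw [← e1]; simp [hx i]
  have f2 : x (!i) ∈ C ∪ D ↔ x (!i) ∈ D := by
    nth_rw 2 [← e2]; simp [hx (!i)]
  refine ⟨⟨?_, p, fun j => ?_⟩, e1⟩
  · intro z hz
    have : z ∈ K i ∪ K !i := hz.imp (@hCK z) (@hDK z)
    cases i
    · exact this.symm
    · exact this
  · rcases Bool.eq_or_eq_not j i with hj | hj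
    · subst hj
      rw [e1, f1, f2]
      exact ⟨hC, h.1⟩
    · subst hj
      rw [Bool.not_not, e2, f1, f2]
      exact ⟨hD, h.2⟩

theorem union_aux {α : Type*} {B C D F : Set α} (h1 : B ⊆ C) (h2 : F ⊆ D) :
    C ∪ D = (B ∪ F) ∪ (C \ B ∪ D \ F) := by
  rw [union_union_union_comm, union_sdiff_cancel h1, union_sdiff_cancel h2]

theorem split_aux (hY : IsTrimPartition S Y) {K : Bool → Set W} {x : Bool → W}
    (hK : ∀ i, Disjoint (K i) (K !i)) (hx : ∀ i, x i ∈ K i)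
    (hI : ∀ i, Iw S Y (x i) = Iw S Y (x !i)) (G : Set W) (i : Bool) (n : ℕ) :
    ∀ (E : Finset (Set W)) (C D : Set W) (p : P), E.card = n → Dec S Y G C E →
      IsTrimAt S Y C p → IsTrimAt S Y D p → C ⊆ K i → D ⊆ K (!i) →
      (x i ∈ C ↔ x (!i) ∈ D) → Spl (BalDec S Y K x G i) (C ∪ D) := by
  classical
  induction n with
  | zero =>
    intro E C D p hn hE hC
    rw [Finset.card_eq_zero] at hn
    subst hn
    obtain ⟨y, hy, -⟩ := exists_pt_self hC
    rw [← hE.2.2] at hy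
    simp at hy
  | succ n ih =>
    intro E C D p hn hE hC hD hCK hDK hiff
    obtain ⟨y, hy, hyp⟩ := exists_pt_self hC
    have hy' := hy
    rw [← hE.2.2] at hy'
    obtain ⟨E0, hE0, hyE0⟩ := hy'
    by_cases hall : ∀ B ∈ E, B = E0
    · have hCE : C = E0 := by
        rw [← hE.2.2]
        refine subset_antisymm (sUnion_subset fun B hB => (hall B hB).le) ?_
        exact subset_sUnion_of_mem hE0
      obtain ⟨h1, h2⟩ := mkBal hK hx i hC hD hCK hDK hiff
      refine Spl.base _ ⟨h1, ?_⟩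
      rw [h2, hCE]
      exact (hE.1 E0 hE0).2
    · push Not at hall
      obtain ⟨B, hB, hBE⟩ := hall
      obtain ⟨⟨r, hr⟩, hBG⟩ := hE.1 B hB
      have hBC : B ⊆ C := by rw [← hE.2.2]; exact subset_sUnion_of_mem hB
      have hd : Disjoint B E0 := hE.2.1 hB hE0 hBE
      have hyB : y ∉ B := fun h => disjoint_left.1 hd h hyE0
      have hpr : S.lt p r := by
        rcases type_mono hr hC hBC with h | h
        · exact h
        · subst h
          by_contra hpp
          obtain ⟨z, hz, hzp⟩ := exists_pt_self hr
          have := (hC.2.2.2 hpp).unique ⟨hBC hz, hzp⟩ ⟨hy, hyp⟩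
          rw [this] at hz
          exact hyB hz
      obtain ⟨F, hF, hFD, hDF, hxF⟩ := carve hY hD hpr (x !i) (x i ∈ B) fun h =>
        ⟨hiff.1 (hBC h), by rw [← hI]; exact ⟨B, hr, h⟩⟩
      have hCB := diff_trim hY hC hr hy hyp hyB
      have hrec := ih (E.erase B) (C \ B) (D \ F) p
        (by rw [Finset.card_erase_of_mem hB, hn]; rfl) ?_ hCB hDF (sdiff_subset.trans hCK)
        (sdiff_subset.trans hDK) (by simp only [Set.mem_sdiff, hxF, hiff])
      · obtain ⟨h1, h2⟩ := mkBal hK hx i hr hF (hBC.trans hCK) (hFD.trans hDK) hxF.symm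
        have hb : BalDec S Y K x G i (B ∪ F) := ⟨h1, by rw [h2]; exact hBG⟩
        have e : C ∪ D = (B ∪ F) ∪ (C \ B ∪ D \ F) := union_aux hBC hFD
        rw [e]
        refine Spl.union _ _ (Spl.base _ hb) hrec ?_
        rw [disjoint_left]
        have hKi := disjoint_left.1 (hK i)
        rintro z (hz | hz) (hz' | hz')
        · exact hz'.2 hz
        · exact hKi (hCK (hBC hz)) (hDK hz'.1)
        · exact hKi (hCK hz'.1) (hDK (hFD hz))
        · exact hz'.2 hz
      · refine ⟨fun A hA => hE.1 A (Finset.mem_of_mem_erase hA),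
          hE.2.1.subset fun A hA => Finset.mem_of_mem_erase hA, ?_⟩
        ext z
        rw [← hE.2.2]
        simp only [mem_sUnion, Finset.mem_coe, Finset.mem_erase, Set.mem_sdiff]
        constructor
        · rintro ⟨A, ⟨hA1, hA2⟩, hz⟩
          exact ⟨⟨A, hA2, hz⟩, fun hzB => disjoint_left.1 (hE.2.1 hA2 hB hA1) hz hzB⟩
        · rintro ⟨⟨A, hA, hz⟩, hzB⟩
          exact ⟨A, ⟨fun h => hzB (h ▸ hz), hA⟩, hz⟩

theorem split (hY : IsTrimPartition S Y) {K : Bool → Set W} {x : Bool → W}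
    (hK : ∀ i, Disjoint (K i) (K !i)) (hx : ∀ i, x i ∈ K i)
    (hI : ∀ i, Iw S Y (x i) = Iw S Y (x !i)) {G : Set W} (hG : IsClopen G) (i : Bool)
    {E : Set W} (hE : Bal S Y K x E) : Spl (BalDec S Y K x G i) E := by
  obtain ⟨h1, p, hp⟩ := hE
  have e : E = E ∩ K i ∪ E ∩ K (!i) := by
    rw [← inter_union_distrib_left]
    refine (inter_eq_left.2 ?_).symm
    cases i
    · rw [union_comm]; exact h1
    · exact h1
  obtain ⟨L, hL⟩ := dec_exists hY hG (hp i).1.1 (hp i).1.2.1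
  rw [e]
  refine split_aux hY hK hx hI G i _ L _ _ p rfl hL (hp i).1 (hp !i).1 inter_subset_right
    inter_subset_right ?_
  simp only [mem_inter_iff, hx, and_true]
  refine ⟨(hp i).2, fun h => ?_⟩
  have := (hp !i).2 h
  rwa [Bool.not_not] at this

theorem homeo_exists [SecondCountableTopology W] (hY : IsTrimPartition S Y)
    {K : Bool → Set W} {x : Bool → W}
    (hK : ∀ i, Disjoint (K i) (K !i)) (hx : ∀ i, x i ∈ K i)
    (hI : ∀ i, Iw S Y (x i) = Iw S Y (x !i)) {p : P} (hp : ∀ i, IsTrimAt S Y (K i) p) :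
    ∃ h : W ≃ₜ W, (∀ a, Iw S Y (h a) = Iw S Y a) ∧ h (x true) = x false := by
  classical
  have : Nonempty W := ⟨x true⟩
  obtain ⟨G, hG, hb⟩ := base_exists hY
  have hGc : ∀ n, IsClopen (G n) := fun n => by
    obtain ⟨q, hq⟩ := hG n
    exact ⟨hq.1.isClosed, hq.2.1⟩
  obtain ⟨e, he⟩ := exists_surjective_nat (ℕ × Bool)
  have hs : ∀ (n : ℕ) (E : Set W), ∃ s : W → Set W, Bal S Y K x E → ∀ a ∈ E, a ∈ s a ∧ s a ⊆ E ∧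
      BalDec S Y K x (G (e n).1) (e n).2 (s a) ∧ ∀ b ∈ s a, s b = s a := by
    intro n E
    by_cases hE : Bal S Y K x E
    · obtain ⟨s, hs⟩ := (split hY hK hx hI (hGc (e n).1) (e n).2 hE).fn
      exact ⟨s, fun _ => hs⟩
    · exact ⟨fun _ => ∅, fun h => absurd h hE⟩
  choose s hs using hs
  let KK := K true ∪ K false
  have hKK : ∀ i, K i ⊆ KK := by
    intro i; cases i
    · exact subset_union_right
    · exact subset_union_left
  have hKK' : ∀ a ∈ KK, ∃ i, a ∈ K i := by
    rintro a (h | h)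
    · exact ⟨_, h⟩
    · exact ⟨_, h⟩
  have hbK : Bal S Y K x KK := by
    refine ⟨subset_rfl, p, fun i => ⟨?_, fun _ => hKK _ (hx _)⟩⟩
    rw [inter_eq_right.2 (hKK i)]
    exact hp i
  let cell : ℕ → W → Set W := fun n a => Nat.rec KK (fun n E => s n E a) n
  have hc0 : ∀ a, cell 0 a = KK := fun a => rfl
  have hcs : ∀ n a, cell (n + 1) a = s n (cell n a) a := fun n a => rfl
  have hcell : ∀ n, ∀ a ∈ KK, a ∈ cell n a ∧ Bal S Y K x (cell n a) ∧ cell n a ⊆ KK ∧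
      ∀ b ∈ cell n a, cell n b = cell n a := by
    intro n
    induction n with
    | zero => intro a ha; exact ⟨ha, hbK, subset_rfl, fun _ _ => rfl⟩
    | succ n ih =>
      intro a ha
      obtain ⟨h1, h2, h3, h4⟩ := ih a ha
      obtain ⟨g1, g2, g3, g4⟩ := hs n (cell n a) h2 a h1
      rw [hcs]
      refine ⟨g1, g3.1, g2.trans h3, fun b hb => ?_⟩
      rw [hcs, h4 b (g2 hb)]
      exact g4 b hb
  have hmono : ∀ n, ∀ a ∈ KK, cell (n + 1) a ⊆ cell n a := by
    intro n a ha
    obtain ⟨h1, h2, h3, h4⟩ := hcell n a ha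
    exact (hs n (cell n a) h2 a h1).2.1
  -- small cells
  have hsmall : ∀ a ∈ KK, ∀ i, ∀ y ∈ K i, (∀ n, y ∈ cell n a) → ∀ U, IsOpen U → y ∈ U →
      ∃ n, cell n a ∩ K i ⊆ U := by
    intro a ha i y hy hya U hU hyU
    obtain ⟨m, h1, h2⟩ := hb y U hU hyU
    obtain ⟨n, hn⟩ := he (m, i)
    refine ⟨n + 1, ?_⟩
    obtain ⟨g1, g2, g3, g4⟩ := hcell n a ha
    have h := (hs n (cell n a) g2 a g1).2.2.1.2
    rw [hn] at h
    rcases h with h | h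
    · exact h.trans h2
    · exact absurd h1 (h ⟨hya (n + 1), hy⟩)
  have huniq : ∀ a ∈ KK, ∀ i, ∀ y ∈ K i, ∀ z ∈ K i, (∀ n, y ∈ cell n a) →
      (∀ n, z ∈ cell n a) → y = z := by
    intro a ha i y hy z hz hya hza
    by_contra hne
    obtain ⟨n, hn⟩ := hsmall a ha i y hy hya {z}ᶜ isOpen_compl_singleton hne
    exact hn ⟨hza n, hz⟩ rfl
  have hex : ∀ a ∈ KK, ∀ i, ∃ y ∈ K i, ∀ n, y ∈ cell n a := by
    intro a ha i
    obtain ⟨y, hy⟩ := IsCompact.nonempty_iInter_of_sequence_nonempty_isCompact_isClosed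
      (fun n => cell n a ∩ K i) (fun n => inter_subset_inter_left _ (hmono n a ha))
      (fun n => by
        obtain ⟨-, ⟨-, q, hq⟩, -⟩ := hcell n a ha
        obtain ⟨y, hy, -⟩ := exists_pt_self (hq i).1
        exact ⟨y, hy⟩)
      (by
        obtain ⟨-, ⟨-, q, hq⟩, -⟩ := hcell 0 a ha
        exact (hq i).1.1)
      (fun n => by
        obtain ⟨-, ⟨-, q, hq⟩, -⟩ := hcell n a ha
        exact (hq i).1.1.isClosed)
    rw [mem_iInter] at hy
    exact ⟨y, (hy 0).2, fun n => (hy n).1⟩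
  have hh : ∀ a, ∃ y, (∀ i, a ∈ K i → y ∈ K (!i) ∧ ∀ n, y ∈ cell n a) ∧ (a ∉ KK → y = a) := by
    intro a
    by_cases ha : a ∈ KK
    · obtain ⟨i, hi⟩ := hKK' a ha
      obtain ⟨y, h1, h2⟩ := hex a ha (!i)
      refine ⟨y, fun j hj => ?_, fun h => absurd ha h⟩
      rcases Bool.eq_or_eq_not j i with hji | hji
      · subst hji; exact ⟨h1, h2⟩
      · subst hji; exact absurd hj (disjoint_left.1 (hK i) hi)
    · exact ⟨a, fun i hi => absurd (hKK i hi) ha, fun _ => rfl⟩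
  choose h hh1 hh2 using hh
  have hinv : Function.Involutive h := by
    intro a
    by_cases ha : a ∈ KK
    · obtain ⟨i, hi⟩ := hKK' a ha
      obtain ⟨h1, h2⟩ := hh1 a i hi
      obtain ⟨h3, h4⟩ := hh1 (h a) (!i) h1
      rw [Bool.not_not] at h3
      refine huniq a ha i _ h3 _ hi (fun n => ?_) fun n => (hcell n a ha).1
      rw [← (hcell n a ha).2.2.2 _ (h2 n)]
      exact h4 n
    · rw [hh2 a ha, hh2 a ha]
  have hmap : ∀ n i, ∀ a ∈ KK, ∀ b ∈ cell n a ∩ K i, h b ∈ cell n a ∩ K (!i) := by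
    intro n i a ha b hb
    obtain ⟨h1, h2⟩ := hh1 b i hb.2
    refine ⟨?_, h1⟩
    rw [← (hcell n a ha).2.2.2 _ hb.1]
    exact h2 n
  have hcont : Continuous h := by
    rw [continuous_iff_continuousAt]
    intro a
    rw [ContinuousAt, tendsto_nhds]
    intro U hU haU
    by_cases ha : a ∈ KK
    · obtain ⟨i, hi⟩ := hKK' a ha
      obtain ⟨h1, h2⟩ := hh1 a i hi
      obtain ⟨n, hn⟩ := hsmall a ha (!i) (h a) h1 h2 U hU haU
      obtain ⟨g1, ⟨-, q, hq⟩, -⟩ := hcell n a ha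
      filter_upwards [(hq i).1.2.1.mem_nhds ⟨g1, hi⟩] with b hb
      exact hn (hmap n i a ha b hb)
    · have hKc : IsClosed KK := (hp true).1.isClosed.union (hp false).1.isClosed
      rw [hh2 a ha] at haU
      filter_upwards [hKc.isOpen_compl.mem_nhds ha, hU.mem_nhds haU] with b hb1 hb2
      change h b ∈ U
      rwa [hh2 b hb1]
  have hle : ∀ a, Iw S Y a ⊆ Iw S Y (h a) := by
    intro a r hr
    by_cases ha : a ∈ KK
    · obtain ⟨i, hi⟩ := hKK' a ha
      obtain ⟨R, hR, haR⟩ := hr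
      obtain ⟨n, hn⟩ := hsmall a ha i a hi (fun n => (hcell n a ha).1) R hR.2.1 haR
      obtain ⟨g1, ⟨-, q, hq⟩, -⟩ := hcell n a ha
      exact Iw_lower hY ⟨_, (hq (!i)).1, hmap n i a ha a ⟨g1, hi⟩⟩ (type_mono (hq i).1 hR hn)
    · rwa [hh2 a ha]
  refine ⟨⟨hinv.toPerm, hcont, hcont⟩, fun a => ?_, ?_⟩
  · refine subset_antisymm ?_ (hle a)
    have := hle (h a)
    rwa [hinv a] at this
  · have hx1 := hKK _ (hx true)
    obtain ⟨h1, h2⟩ := hh1 (x true) true (hx true)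
    refine huniq (x true) hx1 false _ h1 _ (hx false) h2 fun n => ?_
    obtain ⟨g1, ⟨-, q, hq⟩, -⟩ := hcell n _ hx1
    exact (hq true).2 g1

theorem orbit [SecondCountableTopology W] (hY : IsTrimPartition S Y) {w x : W}
    (hwx : Iw S Y w = Iw S Y x) : ∃ h : W ≃ₜ W, (∀ p, h '' Y p = Y p) ∧ h w = x := by
  by_cases hne : w = x
  · exact ⟨Homeomorph.refl W, by simp, hne⟩
  obtain ⟨U, V, hU, hV, hwU, hxV, hUV⟩ := t2_separation hne
  obtain ⟨A, ⟨p1, hA⟩, hwA, hAU⟩ := hY.2.1 w U (hU.mem_nhds hwU)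
  obtain ⟨B, ⟨p2, hB⟩, hxB, hBV⟩ := hY.2.1 x V (hV.mem_nhds hxV)
  obtain ⟨p, hp, h1, h2⟩ := (Iw_ideal hY w).2.2 p1 ⟨A, hA, hwA⟩ p2 (by
    rw [hwx]; exact ⟨B, hB, hxB⟩)
  obtain ⟨a, ha, hap⟩ := exists_pt hA h1
  obtain ⟨b, hb, hbp⟩ := exists_pt hB h2
  obtain ⟨A', hA', hwA', hAA⟩ := shrink hY hp hA.2.1 hwA ha hap
  obtain ⟨B', hB', hxB', hBB⟩ := shrink hY (hwx ▸ hp) hB.2.1 hxB hb hbp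
  have hd : Disjoint A' B' := hUV.mono (hAA.trans hAU) (hBB.trans hBV)
  obtain ⟨h, hh, hw⟩ := homeo_exists hY (K := fun i => if i then A' else B')
    (x := fun i => if i then w else x) (p := p)
    (by intro i; cases i <;> simp [hd, hd.symm]) (by intro i; cases i <;> simp [hwA', hxB'])
    (by intro i; cases i <;> simp [hwx]) (by intro i; cases i <;> simp [hA', hB'])
  refine ⟨h, fun p => ?_, by simpa using hw⟩
  ext z
  constructor
  · rintro ⟨y, hy, rfl⟩
    rw [← Iw_principal_iff hY] at hy ⊢
    rw [hh, hy]
  · intro hz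
    refine ⟨h.symm z, ?_, by simp⟩
    rw [← Iw_principal_iff hY] at hz ⊢
    rw [← hh, h.apply_symm_apply, hz]

theorem Iw_homeo {h : W ≃ₜ W} (hh : ∀ p, h '' Y p = Y p) (w : W) :
    Iw S Y w ⊆ Iw S Y (h w) := by
  rintro p ⟨A, hA, hw⟩
  have hmem : ∀ q z, h z ∈ Y q ↔ z ∈ Y q := fun q z => by
    nth_rw 1 [← hh q]
    exact h.injective.mem_set_image
  refine ⟨h '' A, ⟨hA.1.image h.continuous, h.isOpenMap _ hA.2.1, ?_, fun hp => ?_⟩,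
    mem_image_of_mem _ hw⟩
  · rw [← hA.2.2.1]
    ext q
    constructor
    · rintro ⟨_, ⟨z, hz, rfl⟩, hzq⟩
      exact ⟨z, hz, (hmem q z).1 hzq⟩
    · rintro ⟨z, hz, hzq⟩
      exact ⟨h z, ⟨z, hz, rfl⟩, (hmem q z).2 hzq⟩
  · obtain ⟨y, hy, hu⟩ := hA.2.2.2 hp
    refine ⟨h y, ⟨⟨y, hy.1, rfl⟩, (hmem p y).2 hy.2⟩, ?_⟩
    rintro _ ⟨⟨z, hz, rfl⟩, hzq⟩
    exact congrArg h (hu z ⟨hz, (hmem p z).1 hzq⟩)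

theorem idle_iff {J K : {J : Set P // IsIdeal S J}} : (idPO S).le J K ↔ J.1 ⊆ K.1 := by
  constructor
  · rintro ((⟨h, -⟩ | ⟨h, -⟩) | h)
    · exact h
    · rw [h]
    · rw [h]
  · intro h
    by_cases hJK : J = K
    · exact Or.inr hJK
    · exact Or.inl (Or.inl ⟨h, hJK⟩)

theorem sep_of_principal (p : P) :
    Separated (idPO S) ⟨principalIdeal S p, principal_isIdeal S p⟩ := by
  rintro ⟨u, hu, h1, h2⟩
  have hsub : ∀ n, (u n).1 ⊆ (u (n + 1)).1 := fun n => idle_iff.1 (Or.inl (hu n).1)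
  have hmono : Monotone fun n => (u n).1 := monotone_nat_of_le_succ hsub
  have hU : IsIdeal S (⋃ n, (u n).1) := by
    refine ⟨?_, ?_, ?_⟩
    · obtain ⟨a, ha⟩ := (u 0).2.1
      exact ⟨a, mem_iUnion.2 ⟨0, ha⟩⟩
    · intro a ha b hb
      obtain ⟨n, hn⟩ := mem_iUnion.1 ha
      exact mem_iUnion.2 ⟨n, (u n).2.2.1 a hn b hb⟩
    · intro a ha b hb
      obtain ⟨n, hn⟩ := mem_iUnion.1 ha
      obtain ⟨m, hm⟩ := mem_iUnion.1 hb
      obtain ⟨c, hc, h⟩ := (u (max n m)).2.2.2 a (hmono (le_max_left n m) hn) b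
        (hmono (le_max_right n m) hm)
      exact ⟨c, mem_iUnion.2 ⟨_, hc⟩, h⟩
  have h3 := idle_iff.1 (h2 ⟨_, hU⟩ (by
    rintro _ ⟨n, rfl⟩
    exact idle_iff.2 (subset_iUnion (fun n => (u n).1) n)))
  obtain ⟨n, hn⟩ := mem_iUnion.1 (h3 (show p ∈ principalIdeal S p from Or.inr rfl))
  refine (hu n).2 (Subtype.ext (subset_antisymm (hsub n) ?_))
  intro q hq
  have h4 : q ∈ principalIdeal S p := idle_iff.1 (h1 _ ⟨n + 1, rfl⟩) hq
  exact (u n).2.2.1 p hn q h4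

theorem principal_of_sep [Countable P] {J : {J : Set P // IsIdeal S J}}
    (h : Separated (idPO S) J) : ∃ p, J.1 = principalIdeal S p := by
  by_contra hnp
  push Not at hnp
  apply h
  obtain ⟨e, he⟩ := (Set.to_countable J.1).exists_eq_range J.2.1
  have he' : ∀ n, e n ∈ J.1 := fun n => by rw [he]; exact ⟨n, rfl⟩
  have step : ∀ (n : ℕ) (a : J.1), ∃ b : J.1, S.le a b ∧ S.le (e n) b ∧ a.1 ≠ b.1 := by
    rintro n ⟨a, ha⟩
    have : ∃ c ∈ J.1, ¬ S.le c a := by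
      by_contra hc
      push Not at hc
      exact hnp a (subset_antisymm hc fun q hq => J.2.2.1 a ha q hq)
    obtain ⟨c, hc, hca⟩ := this
    obtain ⟨d, hd, h1, h2⟩ := J.2.2.2 a ha c hc
    obtain ⟨f, hf, h3, h4⟩ := J.2.2.2 d hd (e n) (he' n)
    refine ⟨⟨f, hf⟩, le_trans h1 h3, h4, ?_⟩
    rintro rfl
    exact hca (le_trans h2 h3)
  choose f hf1 hf2 hf3 using step
  let c : ℕ → J.1 := fun n => Nat.rec ⟨e 0, he' 0⟩ (fun n a => f n a) n
  have hc : ∀ n, c (n + 1) = f n (c n) := fun n => rfl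
  refine ⟨fun n => ⟨principalIdeal S (c n).1, principal_isIdeal S _⟩, fun n => ?_, ?_, ?_⟩
  · have hne : (⟨principalIdeal S (c n).1, principal_isIdeal S _⟩ : {J : Set P // IsIdeal S J}) ≠
        ⟨principalIdeal S (c (n + 1)).1, principal_isIdeal S _⟩ := by
      intro h
      exact hf3 n (c n) (principal_inj (congrArg Subtype.val h))
    exact ⟨Or.inl ⟨fun q hq => le_trans hq (hf1 n (c n)), hne⟩, hne⟩
  · rintro _ ⟨n, rfl⟩
    exact idle_iff.2 fun q hq => J.2.2.1 _ (c n).2 q hq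
  · intro K hK
    rw [idle_iff, he]
    rintro _ ⟨n, rfl⟩
    exact idle_iff.1 (hK _ ⟨n + 1, rfl⟩) (hf2 n (c n))

theorem idlt_principal {p : P} : (idPO S).lt ⟨principalIdeal S p, principal_isIdeal S p⟩
    ⟨principalIdeal S p, principal_isIdeal S p⟩ ↔ S.lt p p := by
  constructor
  · rintro (⟨-, h⟩ | ⟨-, h⟩)
    · exact absurd rfl h
    · by_contra hp
      exact h ⟨p, hp, rfl⟩
  · intro h
    refine Or.inr ⟨rfl, ?_⟩
    rintro ⟨q, hq, hpq⟩
    rw [principal_inj hpq] at h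
    exact hq h

theorem limit_iff [SecondCountableTopology W] (hY : IsTrimPartition S Y)
    (J : {J : Set P // IsIdeal S J}) (w : W) :
    w ∈ limitPts {w | Iw S Y w = J.1} ↔ (idPO S).lt ⟨Iw S Y w, Iw_ideal hY w⟩ J := by
  constructor
  · intro hw
    have hw' : ∀ U, IsOpen U → w ∈ U → ∃ x ∈ U, Iw S Y x = J.1 ∧ x ≠ w := by
      intro U hU hwU
      obtain ⟨x, h1, h2, h3⟩ := mem_closure_iff.1 hw U hU hwU
      exact ⟨x, h1, h2, h3⟩
    have hsub : Iw S Y w ⊆ J.1 := by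
      rintro r ⟨A, hA, hwA⟩
      obtain ⟨x, h1, h2, h3⟩ := hw' A hA.2.1 hwA
      rw [← h2]
      exact ⟨A, hA, h1⟩
    by_cases heq : Iw S Y w = J.1
    · refine Or.inr ⟨Subtype.ext heq, ?_⟩
      rintro ⟨p, hp, hwp⟩
      have hwp : Iw S Y w = principalIdeal S p := hwp
      have hwY := (Iw_principal_iff hY).1 hwp
      obtain ⟨A, hA, hwA⟩ := hY.2.2.2 p w hwY
      obtain ⟨x, h1, h2, h3⟩ := hw' A hA.2.1 hwA
      rw [← heq, hwp, Iw_principal_iff hY] at h2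
      exact h3 ((hA.2.2.2 hp).unique ⟨h1, h2⟩ ⟨hwA, hwY⟩)
    · exact Or.inl ⟨hsub, fun h => heq (congrArg Subtype.val h)⟩
  · intro hlt
    have hsub : Iw S Y w ⊆ J.1 := idle_iff.1 (Or.inl hlt)
    refine mem_closure_iff.2 fun U hU hwU => ?_
    obtain ⟨A, ⟨p, hA⟩, hwA, hAU⟩ := hY.2.1 w U (hU.mem_nhds hwU)
    have hpJ : p ∈ J.1 := hsub ⟨A, hA, hwA⟩
    suffices ∃ x ∈ A, Iw S Y x = J.1 ∧ x ≠ w by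
      obtain ⟨x, h1, h2, h3⟩ := this
      exact ⟨x, hAU h1, h2, h3⟩
    by_cases hwY : w ∈ Y p
    · have hwp := (Iw_principal_iff hY).2 hwY
      by_cases hJ : Iw S Y w = J.1
      · have hpp : S.lt p p := by
          rcases hlt with ⟨-, h⟩ | ⟨-, h⟩
          · exact absurd (Subtype.ext hJ) h
          · by_contra hpp
            exact h ⟨p, hpp, hwp⟩
        obtain ⟨z, hz, hzp, hzw⟩ := limit hY hpp hwY hA.2.1 hwA
        exact ⟨z, hz, by rw [← hJ, hwp]; exact (Iw_principal_iff hY).2 hzp, hzw⟩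
      · obtain ⟨x, hx, hxJ⟩ := exists_Iw hY hA J.2 hpJ
        exact ⟨x, hx, hxJ, fun h => hJ (h ▸ hxJ)⟩
    · obtain ⟨y, hy, hyp⟩ := exists_pt_self hA
      have hyw : y ≠ w := fun h => hwY (h ▸ hyp)
      obtain ⟨F, hF, -, hFA⟩ := nbhd hY hyp (hA.2.1.sdiff (isClosed_singleton (x := w))) ⟨hy, hyw⟩
      obtain ⟨x, hx, hxJ⟩ := exists_Iw hY hF J.2 hpJ
      exact ⟨x, (hFA hx).1, hxJ, (hFA hx).2⟩

theorem rank [SecondCountableTopology W] (hY : IsTrimPartition S Y) :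
    IsRankPartition (idPO S)
      (fun J : {J : Set P // IsIdeal S J} => {w : W | Iw S Y w = J.1}) := by
  have := countable_P hY
  refine ⟨⟨?_, ?_, ?_⟩, ?_, ?_, ?_⟩
  · intro J
    obtain ⟨p, hp⟩ := J.2.1
    obtain ⟨y, hy⟩ := hY.1.1 p
    obtain ⟨A, hA, -⟩ := hY.2.2.2 p y hy
    obtain ⟨x, -, hx⟩ := exists_Iw hY hA J.2 hp
    exact ⟨x, hx⟩
  · intro J K hJK
    rw [Set.disjoint_left]
    intro w h1 h2
    exact hJK (Subtype.ext (h1.symm.trans h2))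
  · intro J
    ext w
    have h1 : w ∈ ⋃ q : {J : Set P // IsIdeal S J}, {w : W | Iw S Y w = q.1} :=
      mem_iUnion.2 ⟨⟨_, Iw_ideal hY w⟩, rfl⟩
    rw [mem_inter_iff, limit_iff hY, and_iff_left h1]
    simp only [mem_iUnion]
    constructor
    · intro h
      exact ⟨_, h, rfl⟩
    · rintro ⟨K, hK, hw⟩
      have : (⟨Iw S Y w, Iw_ideal hY w⟩ : {J : Set P // IsIdeal S J}) = K := Subtype.ext hw
      rw [this]
      exact hK
  · exact eq_univ_of_forall fun w => mem_iUnion.2 ⟨⟨_, Iw_ideal hY w⟩, rfl⟩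
  · intro q hq x u τx τu hx hu hlim _ hle _
    obtain ⟨p, hp⟩ := principal_of_sep hq
    have hpx : p ∈ Iw S Y x := by
      have hx : Iw S Y x = τx.1 := hx
      rw [hx]
      exact idle_iff.1 hle (by rw [hp]; exact Or.inr rfl)
    obtain ⟨A, hA, hxA⟩ := hpx
    filter_upwards [hlim (hA.2.1.mem_nhds hxA)] with k hk
    rw [idle_iff, hp]
    intro r hr
    have huk : Iw S Y (u k) = (τu k).1 := hu k
    rw [← huk]
    exact Iw_lower hY ⟨A, hA, hk⟩ hr
  · intro x J hx hJ
    have hx : Iw S Y x = J.1 := hx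
    have hnp : ∀ p, J.1 ≠ principalIdeal S p := by
      intro p hp
      apply hJ
      have : J = ⟨principalIdeal S p, principal_isIdeal S p⟩ := Subtype.ext hp
      rw [this]
      exact sep_of_principal p
    obtain ⟨b, hb⟩ := (nhds x).exists_antitone_basis
    have : ∀ k, ∃ u ∈ b k, ∃ q : {J : Set P // IsIdeal S J}, Iw S Y u = q.1 ∧ (idPO S).lt q J ∧
        q ≠ J := by
      intro k
      obtain ⟨A, ⟨p, hA⟩, hxA, hAb⟩ := hY.2.1 x (b k) (hb.1.mem_of_mem trivial)
      obtain ⟨y, hy, hyp⟩ := exists_pt_self hA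
      have hne : (⟨principalIdeal S p, principal_isIdeal S p⟩ : {J : Set P // IsIdeal S J}) ≠ J :=
        fun h => hnp p (congrArg Subtype.val h).symm
      refine ⟨y, hAb hy, ⟨principalIdeal S p, principal_isIdeal S p⟩,
        (Iw_principal_iff hY).2 hyp, Or.inl ⟨?_, hne⟩, hne⟩
      intro q hq
      exact J.2.2.1 p (by rw [← hx]; exact ⟨A, hA, hxA⟩) q hq
    choose u hu q hq using this
    exact ⟨u, hb.tendsto hu, fun k => ⟨q k, (hq k).1, (hq k).2⟩⟩

theorem id_trim [SecondCountableTopology W] (hY : IsTrimPartition S Y) {A : Set W} {p : P}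
    (hA : IsTrimAt S Y A p) : IsTrimAt (idPO S)
      (fun J : {J : Set P // IsIdeal S J} => {w : W | Iw S Y w = J.1}) A
      ⟨principalIdeal S p, principal_isIdeal S p⟩ := by
  refine ⟨hA.1, hA.2.1, ?_, ?_⟩
  · ext J
    simp only [mem_ofPred_eq, idle_iff]
    constructor
    · rintro ⟨x, hx, hxJ⟩ r hr
      have hxJ : Iw S Y x = J.1 := hxJ
      rw [← hxJ]
      exact Iw_lower hY ⟨A, hA, hx⟩ hr
    · intro h
      obtain ⟨x, hx, hxJ⟩ := exists_Iw hY hA J.2 (h (Or.inr rfl))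
      exact ⟨x, hx, hxJ⟩
  · intro h
    rw [idlt_principal] at h
    have e : {w : W | Iw S Y w = principalIdeal S p} = Y p := by
      ext w; exact Iw_principal_iff hY
    simpa only [e] using hA.2.2.2 h

theorem phat_principal (hY : IsTrimPartition S Y) {J : {J : Set P // IsIdeal S J}} {A : Set W}
    (hA : IsTrimAt (idPO S)
      (fun J : {J : Set P // IsIdeal S J} => {w : W | Iw S Y w = J.1}) A J) :
    ∃ p : P, J = ⟨principalIdeal S p, principal_isIdeal S p⟩ := by
  obtain ⟨x, hx, hxJ⟩ := exists_pt_self hA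
  have hxJ : Iw S Y x = J.1 := hxJ
  obtain ⟨B, ⟨p, hB⟩, hxB, hBA⟩ := hY.2.1 x A (hA.2.1.mem_nhds hx)
  obtain ⟨y, hy, hyp⟩ := exists_pt_self hB
  have h0 : (idPO S).le J ⟨principalIdeal S p, principal_isIdeal S p⟩ :=
    mem_type hA (hBA hy) (show y ∈ {w | Iw S Y w = principalIdeal S p} from
      (Iw_principal_iff hY).2 hyp)
  have h1 := idle_iff.1 h0
  refine ⟨p, Subtype.ext (subset_antisymm h1 fun q hq => ?_)⟩
  rw [← hxJ]
  exact Iw_lower hY ⟨B, hB, hxB⟩ hq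

end ICP
end Helpers

/-- the ideal completion `id(𝒴)` of a trim `P`-partition `𝒴` of a primitive
ω-Stone space is a rank `id(P)`-partition; its clean interior is `𝒴`; it regularly
extends `𝒴`; and its blocks are the orbits of `W` under `P`-homeomorphisms. -/
theorem ideal_completion_properties {P : Type u} {W : Type v}
    [TopologicalSpace W] [SecondCountableTopology W] [LocallyCompactSpace W]
    [T2Space W] [TotallyDisconnectedSpace W]
    (S : POSystem P) (Y : P → Set W)
    (hW : PrimitiveSpace W) (hY : IsTrimPartition S Y) :
    -- `id(𝒴)` is a rank `id(P)`-partition of `W`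
    IsRankPartition (POSystem.idPO S)
      (fun J : {J : Set P // POSystem.IsIdeal S J} => {w : W | Iw S Y w = J.1}) ∧
    -- (1) the clean interior of `id(𝒴)` equals `𝒴`: the clean points of the block at a
    -- principal ideal `p↓` form exactly `Y p`, and every type in `id(P)^` is principal
    (∀ p : P,
      {w : W | Iw S Y w = POSystem.principalIdeal S p ∧
        IsCleanPt (POSystem.idPO S)
          (fun J : {J : Set P // POSystem.IsIdeal S J} => {w : W | Iw S Y w = J.1}) w}
        = Y p) ∧
    (∀ J ∈ Phat (POSystem.idPO S)
        (fun J : {J : Set P // POSystem.IsIdeal S J} => {w : W | Iw S Y w = J.1}),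
      ∃ p : P, J = ⟨POSystem.principalIdeal S p, POSystem.principal_isIdeal S p⟩) ∧
    -- (2) `id(𝒴)` regularly extends `𝒴`, via the embedding `p ↦ p↓`
    RegRefines S (POSystem.idPO S) Y
      (fun J : {J : Set P // POSystem.IsIdeal S J} => {w : W | Iw S Y w = J.1})
      (fun p : P => ⟨POSystem.principalIdeal S p, POSystem.principal_isIdeal S p⟩) ∧
    -- (3) the blocks of `id(𝒴)` are the orbits of the `P`-homeomorphisms of `W`
    (∀ (J : {J : Set P // POSystem.IsIdeal S J}) (w : W), Iw S Y w = J.1 →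
      {x : W | Iw S Y x = J.1} =
        {x : W | ∃ h : W ≃ₜ W, (∀ p, h '' Y p = Y p) ∧ h w = x}) := by
  refine ⟨ICP.rank hY, ?_, ?_, ⟨?_, ?_⟩, ?_⟩
  · intro p
    ext w
    constructor
    · rintro ⟨h, -⟩
      exact (ICP.Iw_principal_iff hY).1 h
    · intro hw
      obtain ⟨A, hA, hwA⟩ := hY.2.2.2 p w hw
      have h := (ICP.Iw_principal_iff hY).2 hw
      exact ⟨h, ⟨_, principal_isIdeal S p⟩, h, A, ICP.id_trim hY hA, hwA⟩
  · rintro J ⟨A, hA⟩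
    exact ICP.phat_principal hY hA
  · intro p w hw
    exact (ICP.Iw_principal_iff hY).2 hw
  · intro J _ A hA
    obtain ⟨p, rfl⟩ := ICP.phat_principal hY hA
    obtain ⟨x, hx, hxp⟩ := ICP.exists_pt_self hA
    exact ⟨p, ⟨x, hx, (ICP.Iw_principal_iff hY).1 hxp⟩, rfl⟩
  · intro J w hw
    ext x
    constructor
    · intro hx
      exact ICP.orbit hY (hw.trans (Eq.symm hx))
    · rintro ⟨h, hh, rfl⟩
      have h1 := ICP.Iw_homeo (S := S) hh w
      have hh' : ∀ p, h.symm '' Y p = Y p := fun p => by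
        conv_lhs => rw [← hh p]
        rw [← image_comp]
        simp
      have h2 := ICP.Iw_homeo (S := S) hh' (h w)
      rw [h.symm_apply_apply] at h2
      exact (subset_antisymm h2 h1).trans hw
end

section
/- Let W be a primitive ω-Stone space. Then the maps 𝒴 ↦ id(𝒴) (ideal completion) and 𝒵 ↦ 𝒵° (clean interior) are mutually inverse bijections between the set of trim partitions of W and the set of rank partitions of W. In particular, the rank partitions of W are precisely the partitions of the form id(𝒴) for a trim partition 𝒴 of W. -/
open Set Filter Topology

universe u v

open POSystem

section Helpers

theorem po_refl {P : Type*} (S : POSystem P) (p : P) : S.le p p := Or.inr rfl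

theorem po_antisymm {P : Type*} (S : POSystem P) {p q : P} (h1 : S.le p q) (h2 : S.le q p) :
    p = q := by
  rcases h1 with h1 | h1
  · rcases h2 with h2 | h2
    · exact S.lt_antisymm h1 h2
    · exact h2.symm
  · exact h1

theorem compOpens_countable (W : Type*) [TopologicalSpace W] [SecondCountableTopology W] :
    {A : Set W | IsCompact A ∧ IsOpen A}.Countable := by
  have hc : (range fun s : Finset (TopologicalSpace.countableBasis W) =>
      (Subtype.val '' (s : Set (TopologicalSpace.countableBasis W))).sUnion).Countable :=
    countable_range _
  refine hc.mono ?_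
  rintro A ⟨hA, hA'⟩
  obtain ⟨s, hs⟩ := eq_sUnion_finset_of_isTopologicalBasis_of_isCompact_open _
    (TopologicalSpace.isBasis_countableBasis W) A hA hA'
  exact ⟨s, hs.symm⟩

theorem compOpens_enum (W : Type*) [TopologicalSpace W] [SecondCountableTopology W] :
    ∃ E : ℕ → Set W, (∀ n, IsCompact (E n) ∧ IsOpen (E n)) ∧
      ∀ A, IsCompact A → IsOpen A → ∃ n, E n = A := by
  obtain ⟨E, hE⟩ := (compOpens_countable W).exists_eq_range ⟨∅, isCompact_empty, isOpen_empty⟩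
  refine ⟨E, fun n => ?_, fun A h1 h2 => ?_⟩
  · have : E n ∈ range E := ⟨n, rfl⟩
    rw [← hE] at this; exact this
  · have : A ∈ {A : Set W | IsCompact A ∧ IsOpen A} := ⟨h1, h2⟩
    rw [hE] at this; exact this

theorem compOpen_basis {W : Type*} [TopologicalSpace W] [LocallyCompactSpace W]
    [T2Space W] [TotallyDisconnectedSpace W] (w : W) (U : Set W) (hU : U ∈ 𝓝 w) :
    ∃ C, IsCompact C ∧ IsOpen C ∧ w ∈ C ∧ C ⊆ U := by
  obtain ⟨K, hK, hKU, hKc⟩ := local_compact_nhds hU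
  obtain ⟨s, hs, hws, hsK⟩ :=
    (loc_compact_Haus_tot_disc_of_zero_dim (H := W)).mem_nhds_iff.1 hK
  exact ⟨s, hKc.of_isClosed_subset hs.1 hsK, hs.2, hws, hsK.trans hKU⟩

section Trim
variable {W : Type*} [TopologicalSpace W] {P : Type*} {S : POSystem P} {Y : P → Set W}

theorem trim_mem_le {A : Set W} {p q : P} {w : W} (hA : IsTrimAt S Y A p) (hw : w ∈ A)
    (hq : w ∈ Y q) : S.le p q := by
  have : q ∈ ptype Y A := ⟨w, hw, hq⟩
  rw [hA.2.2.1] at this; exact this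

theorem trim_exists {A : Set W} {p q : P} (hA : IsTrimAt S Y A p) (h : S.le p q) :
    ∃ w ∈ A, w ∈ Y q := by
  have : q ∈ ptype Y A := by rw [hA.2.2.1]; exact h
  exact this

theorem trim_union {A B : Set W} {p q : P} (hA : IsTrimAt S Y A p) (hB : IsTrimAt S Y B q)
    (h : S.le q p) (hne : q ≠ p) : IsTrimAt S Y (A ∪ B) q := by
  refine ⟨hA.1.union hB.1, hA.2.1.union hB.2.1, ?_, fun hd => ?_⟩
  · ext r; constructor
    · rintro ⟨x, hx | hx, hr⟩
      · exact POSystem.le_trans h (trim_mem_le hA hx hr)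
      · exact trim_mem_le hB hx hr
    · intro hr
      obtain ⟨w, hw, hw'⟩ := trim_exists hB hr
      exact ⟨w, Or.inr hw, hw'⟩
  · obtain ⟨x, hx, hu⟩ := hB.2.2.2 hd
    refine ⟨x, ⟨Or.inr hx.1, hx.2⟩, ?_⟩
    rintro y ⟨hy | hy, hy'⟩
    · exact absurd (po_antisymm S h (trim_mem_le hA hy hy')) hne
    · exact hu y ⟨hy, hy'⟩

theorem trim_phat (h : IsTrimPartition S Y) (p : P) : ∃ A, IsTrimAt S Y A p := by
  obtain ⟨x, hx⟩ := h.1.1 p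
  obtain ⟨A, hA, _⟩ := h.2.2.2 p x hx
  exact ⟨A, hA⟩

theorem Iw_lower (h : IsTrimPartition S Y) {w : W} {p q : P} (hp : p ∈ Iw S Y w)
    (hq : S.le q p) : q ∈ Iw S Y w := by
  by_cases hne : q = p
  · rw [hne]; exact hp
  obtain ⟨A, hA, hw⟩ := hp
  obtain ⟨B, hB⟩ := trim_phat h q
  exact ⟨A ∪ B, trim_union hA hB hq hne, Or.inl hw⟩

theorem trim_shrink (h : IsTrimPartition S Y) {w : W} {p : P} (hp : p ∈ Iw S Y w) {U : Set W}
    (hU : U ∈ 𝓝 w) : ∃ C r, IsTrimAt S Y C r ∧ w ∈ C ∧ C ⊆ U ∧ S.le p r := by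
  obtain ⟨A, hA, hw⟩ := hp
  obtain ⟨C, ⟨r, hC⟩, hwC, hCU⟩ := h.2.1 w (U ∩ A) (inter_mem hU (hA.2.1.mem_nhds hw))
  obtain ⟨y, hy, hy'⟩ := trim_exists hC (po_refl S r)
  exact ⟨C, r, hC, hwC, hCU.trans inter_subset_left, trim_mem_le hA (hCU hy).2 hy'⟩

theorem Iw_ideal (h : IsTrimPartition S Y) (w : W) : IsIdeal S (Iw S Y w) := by
  refine ⟨?_, fun x hx y hy => Iw_lower h hx hy, ?_⟩
  · obtain ⟨A, ⟨p, hA⟩, hw, _⟩ := h.2.1 w univ univ_mem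
    exact ⟨p, A, hA, hw⟩
  · intro p hp q hq
    obtain ⟨A, hA, hw⟩ := hp
    obtain ⟨C, r, hC, hwC, hCA, hr⟩ := trim_shrink h hq (hA.2.1.mem_nhds hw)
    obtain ⟨y, hy, hy'⟩ := trim_exists hC (po_refl S r)
    exact ⟨r, ⟨C, hC, hwC⟩, trim_mem_le hA (hCA hy) hy', hr⟩

theorem principal_inj {p q : P} (h : principalIdeal S p = principalIdeal S q) : p = q := by
  refine po_antisymm S ?_ ?_
  · have : p ∈ principalIdeal S p := po_refl S p
    rw [h] at this; exact this
  · have : q ∈ principalIdeal S q := po_refl S q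
    rw [← h] at this; exact this

theorem Iw_principal_iff (h : IsTrimPartition S Y) (w : W) (p : P) :
    Iw S Y w = principalIdeal S p ↔ w ∈ Y p := by
  constructor
  · intro hI
    refine h.2.2.1 p (trim_phat h p) w fun U hU => ?_
    have hp : p ∈ Iw S Y w := by rw [hI]; exact po_refl S p
    obtain ⟨C, r, hC, hwC, hCU, hr⟩ := trim_shrink h hp hU
    have hr' : r ∈ Iw S Y w := ⟨C, hC, hwC⟩
    rw [hI] at hr'
    have := po_antisymm S hr hr'
    subst this
    exact ⟨C, hC, hwC, hCU⟩
  · intro hw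
    ext q; constructor
    · rintro ⟨A, hA, hwA⟩
      exact trim_mem_le hA hwA hw
    · intro hq
      obtain ⟨A, hA, hwA⟩ := h.2.2.2 p w hw
      exact Iw_lower h ⟨A, hA, hwA⟩ hq

theorem trim_at_base (h : IsTrimPartition S Y) {w : W} {p : P} (hw : w ∈ Y p) {U : Set W}
    (hU : U ∈ 𝓝 w) : ∃ C, IsTrimAt S Y C p ∧ w ∈ C ∧ C ⊆ U := by
  have hI := (Iw_principal_iff h w p).2 hw
  have hp : p ∈ Iw S Y w := by rw [hI]; exact po_refl S p
  obtain ⟨C, r, hC, hwC, hCU, hr⟩ := trim_shrink h hp hU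
  have := po_antisymm S hr (trim_mem_le hC hwC hw)
  subst this
  exact ⟨C, hC, hwC, hCU⟩

theorem trim_countable [SecondCountableTopology W] (h : IsTrimPartition S Y) : Countable P := by
  choose A hA using trim_phat h
  have : Countable {A : Set W | IsCompact A ∧ IsOpen A} := (compOpens_countable W).to_subtype
  refine Function.Injective.countable
    (f := fun p => (⟨A p, (hA p).1, (hA p).2.1⟩ : {A : Set W | IsCompact A ∧ IsOpen A})) ?_
  intro p q hpq
  have hpq : A p = A q := congrArg Subtype.val hpq
  obtain ⟨x, hx, hx'⟩ := trim_exists (hA p) (po_refl S p)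
  obtain ⟨y, hy, hy'⟩ := trim_exists (hA q) (po_refl S q)
  rw [hpq] at hx
  rw [← hpq] at hy
  exact po_antisymm S (trim_mem_le (hA p) hy hy') (trim_mem_le (hA q) hx hx')

theorem ideal_enum [Countable P] {J : Set P} (hJ : IsIdeal S J) : ∃ e : ℕ → P, J = range e :=
  (Set.to_countable J).exists_eq_range hJ.1

theorem exists_Iw_eq [SecondCountableTopology W] [T2Space W] (h : IsTrimPartition S Y)
    {J : Set P} (hJ : IsIdeal S J) {C : Set W} {r : P} (hC : IsTrimAt S Y C r) (hr : r ∈ J) :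
    ∃ w ∈ C, Iw S Y w = J := by
  have := trim_countable h
  obtain ⟨e, he⟩ := ideal_enum hJ
  obtain ⟨E, hE, hE'⟩ := compOpens_enum W
  let T := {x : Set W × P // IsTrimAt S Y x.1 x.2 ∧ x.2 ∈ J}
  have step : ∀ n : ℕ, ∀ x : T, ∃ y : T, y.1.1 ⊆ x.1.1 ∧ S.le (e n) y.1.2 ∧
      (y.1.1 ⊆ E n ∨ Disjoint y.1.1 (E n)) := by
    rintro n ⟨⟨A, p⟩, hA, hp⟩
    have hen : e n ∈ J := by rw [he]; exact ⟨n, rfl⟩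
    obtain ⟨p', hp', h1, h2⟩ := hJ.2.2 p hp (e n) hen
    obtain ⟨y, hy, hy'⟩ := trim_exists hA h1
    by_cases hyE : y ∈ E n
    · obtain ⟨D, hD, hyD, hDU⟩ := trim_at_base h hy' (U := A ∩ E n)
        ((hA.2.1.inter (hE n).2).mem_nhds ⟨hy, hyE⟩)
      exact ⟨⟨⟨D, p'⟩, hD, hp'⟩, fun z hz => (hDU hz).1, h2, Or.inl fun z hz => (hDU hz).2⟩
    · obtain ⟨D, hD, hyD, hDU⟩ := trim_at_base h hy' (U := A ∩ (E n)ᶜ)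
        ((hA.2.1.inter (hE n).1.isClosed.isOpen_compl).mem_nhds ⟨hy, hyE⟩)
      exact ⟨⟨⟨D, p'⟩, hD, hp'⟩, fun z hz => (hDU hz).1, h2,
        Or.inr (Set.disjoint_left.2 fun z hz => (hDU hz).2)⟩
  choose f hf using step
  let s : ℕ → T := fun n => Nat.rec ⟨⟨C, r⟩, hC, hr⟩ (fun n x => f n x) n
  have hs : ∀ n, s (n + 1) = f n (s n) := fun n => rfl
  obtain ⟨w, hw⟩ := IsCompact.nonempty_iInter_of_sequence_nonempty_isCompact_isClosed
    (fun n => (s n).1.1) (fun n => by simp only [hs]; exact (hf n (s n)).1)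
    (fun n => by
      obtain ⟨x, hx, _⟩ := trim_exists (s n).2.1 (po_refl S _)
      exact ⟨x, hx⟩) (s 0).2.1.1 (fun n => (s n).2.1.1.isClosed)
  rw [mem_iInter] at hw
  refine ⟨w, hw 0, ?_⟩
  ext q; constructor
  · rintro ⟨D, hD, hwD⟩
    obtain ⟨n, hn⟩ := hE' D hD.1 hD.2.1
    have h1 := (hf n (s n)).2.2
    rw [← hs, hn] at h1
    rcases h1 with h1 | h1
    · obtain ⟨y, hy, hy'⟩ := trim_exists (s (n+1)).2.1 (po_refl S _)
      exact hJ.2.1 _ (s (n+1)).2.2 _ (trim_mem_le hD (h1 hy) hy')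
    · exact absurd hwD (Set.disjoint_left.1 h1 (hw (n+1)))
  · intro hq
    rw [he] at hq
    obtain ⟨n, rfl⟩ := hq
    have h1 := (hf n (s n)).2.1
    rw [← hs] at h1
    exact Iw_lower h ⟨_, (s (n+1)).2.1, hw (n+1)⟩ h1

theorem id_le_iff (J K : {J : Set P // IsIdeal S J}) : (idPO S).le J K ↔ J.1 ⊆ K.1 := by
  constructor
  · rintro ((h | h) | h)
    · exact h.1
    · rw [h.1]
    · rw [h]
  · intro h
    by_cases hJK : J = K
    · exact Or.inr hJK
    · exact Or.inl (Or.inl ⟨h, hJK⟩)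

theorem nonprincipal_not_separated [Countable P] (J : {J : Set P // IsIdeal S J})
    (hJ : ¬ ∃ p, J.1 = principalIdeal S p) : ¬ Separated (idPO S) J := by
  obtain ⟨e, he⟩ := ideal_enum J.2
  have step : ∀ n : ℕ, ∀ x : J.1, ∃ y : J.1, S.le x.1 y.1 ∧ x ≠ y ∧ S.le (e n) y.1 := by
    rintro n ⟨p, hp⟩
    have hen : e n ∈ J.1 := by rw [he]; exact ⟨n, rfl⟩
    obtain ⟨p', hp', h1, h2⟩ := J.2.2.2 p hp (e n) hen
    have : ∃ s ∈ J.1, ¬ S.le s p := by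
      by_contra hcon
      push Not at hcon
      exact hJ ⟨p, Subset.antisymm hcon fun q hq => J.2.2.1 p hp q hq⟩
    obtain ⟨s, hs, hsp⟩ := this
    obtain ⟨t, ht, h3, h4⟩ := J.2.2.2 p' hp' s hs
    refine ⟨⟨t, ht⟩, POSystem.le_trans h1 h3, ?_, POSystem.le_trans h2 h3⟩
    intro heq
    have heq : p = t := congrArg Subtype.val heq
    rw [← heq] at h4
    exact hsp h4
  choose f hf using step
  obtain ⟨p0, hp0⟩ := J.2.1
  let s : ℕ → J.1 := fun n => Nat.rec ⟨p0, hp0⟩ (fun n x => f n x) n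
  have hs : ∀ n, s (n + 1) = f n (s n) := fun n => rfl
  refine not_not.2 ⟨fun n => ⟨principalIdeal S (s n).1, principal_isIdeal S _⟩, fun n => ?_, ?_, ?_⟩
  · have h1 := hf n (s n)
    rw [← hs] at h1
    have hne : (⟨principalIdeal S (s n).1, principal_isIdeal S _⟩ : {J : Set P // IsIdeal S J}) ≠
        ⟨principalIdeal S (s (n+1)).1, principal_isIdeal S _⟩ := by
      intro heq
      exact h1.2.1 (Subtype.ext (principal_inj (congrArg Subtype.val heq)))
    exact ⟨Or.inl ⟨fun q hq => POSystem.le_trans hq h1.1, hne⟩, hne⟩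
  · rintro _ ⟨n, rfl⟩
    rw [id_le_iff]
    exact fun q hq => J.2.2.1 _ (s n).2 q hq
  · intro K hK
    rw [id_le_iff, he]
    rintro _ ⟨n, rfl⟩
    have h1 := (id_le_iff _ _).1 (hK _ ⟨n+1, rfl⟩)
    have h2 := (hf n (s n)).2.2
    rw [← hs] at h2
    exact h1 h2

theorem principal_separated (p : P) :
    Separated (idPO S) ⟨principalIdeal S p, principal_isIdeal S p⟩ := by
  rintro ⟨u, hu, hub, hlub⟩
  have hmono : ∀ m n, m ≤ n → (u m).1 ⊆ (u n).1 := by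
    intro m n hmn
    induction hmn with
    | refl => exact Subset.rfl
    | step _ ih => exact ih.trans ((id_le_iff _ _).1 (Or.inl (hu _).1))
  have hid : IsIdeal S (⋃ n, (u n).1) := by
    refine ⟨?_, ?_, ?_⟩
    · obtain ⟨x, hx⟩ := (u 0).2.1
      exact ⟨x, mem_iUnion.2 ⟨0, hx⟩⟩
    · intro x hx y hy
      obtain ⟨n, hn⟩ := mem_iUnion.1 hx
      exact mem_iUnion.2 ⟨n, (u n).2.2.1 x hn y hy⟩
    · intro x hx y hy
      obtain ⟨n, hn⟩ := mem_iUnion.1 hx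
      obtain ⟨m, hm⟩ := mem_iUnion.1 hy
      obtain ⟨z, hz, h1, h2⟩ := (u (max n m)).2.2.2 x (hmono n _ (le_max_left _ _) hn) y
        (hmono m _ (le_max_right _ _) hm)
      exact ⟨z, mem_iUnion.2 ⟨_, hz⟩, h1, h2⟩
  have h1 := (id_le_iff _ _).1 (hlub ⟨_, hid⟩ (by
    rintro _ ⟨n, rfl⟩
    rw [id_le_iff]
    exact subset_iUnion (fun n => (u n).1) n))
  have h2 : p ∈ ⋃ n, (u n).1 := h1 (po_refl S p)
  obtain ⟨n, hn⟩ := mem_iUnion.1 h2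
  have h3 := (id_le_iff _ _).1 (hub _ ⟨n+1, rfl⟩)
  refine (hu n).2 (Subtype.ext (Subset.antisymm (hmono n _ (Nat.le_succ n)) ?_))
  exact h3.trans fun q hq => (u n).2.2.1 p hn q hq

theorem seq_of_nhds {W : Type*} [TopologicalSpace W] [SecondCountableTopology W] (x : W)
    (p : W → Prop) (h : ∀ U ∈ 𝓝 x, ∃ y ∈ U, p y) :
    ∃ u : ℕ → W, Tendsto u atTop (𝓝 x) ∧ ∀ k, p (u k) := by
  have : x ∈ closure {y | p y} := mem_closure_iff_nhds.2 fun U hU => by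
    obtain ⟨y, hy, hy'⟩ := h U hU
    exact ⟨y, hy, hy'⟩
  obtain ⟨u, hu, hu'⟩ := mem_closure_iff_seq_limit.1 this
  exact ⟨u, hu', hu⟩

/-- Trim sets of the original partition are trim for the ideal completion. -/
theorem trim_id [SecondCountableTopology W] [T2Space W] (h : IsTrimPartition S Y)
    {A : Set W} {p : P} (hA : IsTrimAt S Y A p) :
    IsTrimAt (idPO S) (fun J : {J : Set P // IsIdeal S J} => {w : W | Iw S Y w = J.1}) A
      ⟨principalIdeal S p, principal_isIdeal S p⟩ := by
  refine ⟨hA.1, hA.2.1, ?_, ?_⟩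
  · ext K
    constructor
    · rintro ⟨w, hw, hwK⟩
      show (idPO S).le _ _
      rw [id_le_iff]
      have hwK : Iw S Y w = K.1 := hwK
      intro q hq
      rw [← hwK]
      exact Iw_lower h ⟨A, hA, hw⟩ hq
    · intro hK
      have hK := (id_le_iff _ _).1 hK
      obtain ⟨w, hw, hw'⟩ := exists_Iw_eq h K.2 hA (hK (po_refl S p))
      exact ⟨w, hw, hw'⟩
  · intro hd
    have : ∃ p' : P, ¬ S.lt p' p' ∧ principalIdeal S p = principalIdeal S p' := by
      by_contra hcon
      exact hd (Or.inr ⟨rfl, hcon⟩)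
    obtain ⟨p', hp', heq⟩ := this
    obtain rfl := principal_inj heq
    obtain ⟨x, hx, hu⟩ := hA.2.2.2 hp'
    refine ⟨x, ⟨hx.1, (Iw_principal_iff h x p).2 hx.2⟩, ?_⟩
    rintro y ⟨hy, hy'⟩
    exact hu y ⟨hy, (Iw_principal_iff h y p).1 hy'⟩

theorem id_ppartition [SecondCountableTopology W] [T2Space W] (h : IsTrimPartition S Y) :
    IsPPartition (idPO S)
      (fun J : {J : Set P // IsIdeal S J} => {w : W | Iw S Y w = J.1}) := by
  refine ⟨?_, ?_, ?_⟩
  · intro J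
    obtain ⟨p, hp⟩ := J.2.1
    obtain ⟨A, hA⟩ := trim_phat h p
    obtain ⟨w, _, hw⟩ := exists_Iw_eq h J.2 hA hp
    exact ⟨w, hw⟩
  · intro J K hJK
    refine Set.disjoint_left.2 fun w hw hw' => hJK (Subtype.ext ?_)
    have hw : Iw S Y w = J.1 := hw
    have hw' : Iw S Y w = K.1 := hw'
    rw [← hw, hw']
  · intro K
    ext w
    constructor
    · rintro ⟨hw, -⟩
      have hw := mem_closure_iff_nhds.1 hw
      refine mem_iUnion₂.2 ⟨⟨Iw S Y w, Iw_ideal h w⟩, ?_, rfl⟩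
      have hsub : Iw S Y w ⊆ K.1 := by
        rintro r ⟨A, hA, hwA⟩
        obtain ⟨w', hw'A, hw'K, _⟩ := hw A (hA.2.1.mem_nhds hwA)
        have hw'K : Iw S Y w' = K.1 := hw'K
        rw [← hw'K]
        exact ⟨A, hA, hw'A⟩
      by_cases heq : (⟨Iw S Y w, Iw_ideal h w⟩ : {J : Set P // IsIdeal S J}) = K
      · refine Or.inr ⟨heq, ?_⟩
        rintro ⟨p, hp, hp'⟩
        have hp' : Iw S Y w = principalIdeal S p := hp'
        have hwY := (Iw_principal_iff h w p).1 hp'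
        obtain ⟨A, hA, hwA⟩ := h.2.2.2 p w hwY
        obtain ⟨w', hw'A, hw'K, hne⟩ := hw A (hA.2.1.mem_nhds hwA)
        have hw'K : Iw S Y w' = K.1 := hw'K
        have hK : Iw S Y w = K.1 := congrArg Subtype.val heq
        rw [← hK, hp', Iw_principal_iff h] at hw'K
        exact hne ((hA.2.2.2 hp).unique ⟨hw'A, hw'K⟩ ⟨hwA, hwY⟩)
      · exact Or.inl ⟨hsub, heq⟩
    · intro hw
      obtain ⟨J, hJK, hwJ⟩ := mem_iUnion₂.1 hw
      have hwJ : Iw S Y w = J.1 := hwJ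
      refine ⟨?_, mem_iUnion.2 ⟨J, hwJ⟩⟩
      rcases hJK with ⟨hsub, hne⟩ | ⟨rfl, hnp⟩
      · refine mem_closure_iff_nhds.2 fun U hU => ?_
        obtain ⟨C, ⟨r, hC⟩, hwC, hCU⟩ := h.2.1 w U hU
        have hr : r ∈ J.1 := by rw [← hwJ]; exact ⟨C, hC, hwC⟩
        obtain ⟨w', hw', hw'K⟩ := exists_Iw_eq h K.2 hC (hsub hr)
        refine ⟨w', hCU hw', hw'K, ?_⟩
        rintro rfl
        exact hne (Subtype.ext (hwJ.symm.trans hw'K))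
      · by_cases hpr : ∃ p, J.1 = principalIdeal S p
        · obtain ⟨p, hp⟩ := hpr
          have hpp : S.lt p p := by
            by_contra hcon
            exact hnp ⟨p, hcon, hp⟩
          rw [hp, Iw_principal_iff h] at hwJ
          have h1 : w ∈ limitPts (Y p) ∩ ⋃ q, Y q := by
            rw [h.1.2.2 p]
            exact mem_iUnion₂.2 ⟨p, hpp, hwJ⟩
          refine closure_mono ?_ h1.1
          rintro y ⟨hy, hy'⟩
          exact ⟨by rw [mem_ofPred_eq, hp]; exact (Iw_principal_iff h y p).2 hy, hy'⟩
        · refine mem_closure_iff_nhds.2 fun U hU => ?_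
          obtain ⟨C, ⟨r, hC⟩, hwC, hCU⟩ := h.2.1 w U hU
          have hr : r ∈ J.1 := by rw [← hwJ]; exact ⟨C, hC, hwC⟩
          obtain ⟨y, hy, hyr⟩ := trim_exists hC (po_refl S r)
          have hyw : y ≠ w := by
            rintro rfl
            exact hpr ⟨r, hwJ.symm.trans ((Iw_principal_iff h y r).2 hyr)⟩
          obtain ⟨D, hD, hyD, hDU⟩ := trim_at_base h hyr (U := C ∩ {w}ᶜ)
            ((hC.2.1.inter isOpen_compl_singleton).mem_nhds ⟨hy, hyw⟩)
          obtain ⟨w', hw', hw'K⟩ := exists_Iw_eq h J.2 hD hr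
          exact ⟨w', hCU (hDU hw').1, hw'K, (hDU hw').2⟩

theorem id_rank [SecondCountableTopology W] [T2Space W] (h : IsTrimPartition S Y) :
    IsRankPartition (idPO S)
      (fun J : {J : Set P // IsIdeal S J} => {w : W | Iw S Y w = J.1}) := by
  have hcount := trim_countable h
  refine ⟨id_ppartition h, ?_, ?_, ?_⟩
  · exact eq_univ_of_forall fun w => mem_iUnion.2 ⟨⟨_, Iw_ideal h w⟩, rfl⟩
  · intro J hJ x u τx τu hx hu hlim _ hle _
    have hpr : ∃ p, J.1 = principalIdeal S p := by
      by_contra hcon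
      exact nonprincipal_not_separated J hcon hJ
    obtain ⟨p, hp⟩ := hpr
    have hx : Iw S Y x = τx.1 := hx
    have h1 := (id_le_iff _ _).1 hle
    have hpx : p ∈ Iw S Y x := by
      rw [hx]; apply h1; rw [hp]; exact po_refl S p
    obtain ⟨A, hA, hxA⟩ := hpx
    filter_upwards [hlim (hA.2.1.mem_nhds hxA)] with k hk
    rw [id_le_iff, hp]
    have huk : Iw S Y (u k) = (τu k).1 := hu k
    rw [← huk]
    exact fun q hq => Iw_lower h ⟨A, hA, hk⟩ hq
  · intro x J hx hJ
    have hx : Iw S Y x = J.1 := hx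
    have hnp : ¬ ∃ p, J.1 = principalIdeal S p := by
      rintro ⟨p, hp⟩
      have : J = ⟨principalIdeal S p, principal_isIdeal S p⟩ := Subtype.ext hp
      rw [this] at hJ
      exact hJ (principal_separated p)
    refine seq_of_nhds x (fun y => ∃ q : {J : Set P // IsIdeal S J},
      y ∈ {w : W | Iw S Y w = q.1} ∧ (idPO S).lt q J ∧ q ≠ J) fun U hU => ?_
    obtain ⟨C, ⟨r, hC⟩, hwC, hCU⟩ := h.2.1 x U hU
    have hr : r ∈ J.1 := by rw [← hx]; exact ⟨C, hC, hwC⟩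
    obtain ⟨y, hy, hyr⟩ := trim_exists hC (po_refl S r)
    have hne : (⟨principalIdeal S r, principal_isIdeal S r⟩ : {J : Set P // IsIdeal S J}) ≠ J :=
      fun heq => hnp ⟨r, (congrArg Subtype.val heq).symm⟩
    exact ⟨y, hCU hy, ⟨principalIdeal S r, principal_isIdeal S r⟩,
      (Iw_principal_iff h y r).2 hyr,
      Or.inl ⟨fun q hq => J.2.2.1 r hr q hq, hne⟩, hne⟩

theorem id_clean [SecondCountableTopology W] [T2Space W] (h : IsTrimPartition S Y) (p : P) :
    {w : W | Iw S Y w = principalIdeal S p ∧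
          IsCleanPt (idPO S)
            (fun J : {J : Set P // IsIdeal S J} => {w : W | Iw S Y w = J.1}) w} = Y p := by
  ext w
  constructor
  · rintro ⟨hw, -⟩
    exact (Iw_principal_iff h w p).1 hw
  · intro hw
    have hI := (Iw_principal_iff h w p).2 hw
    obtain ⟨A, hA, hwA⟩ := h.2.2.2 p w hw
    exact ⟨hI, ⟨principalIdeal S p, principal_isIdeal S p⟩, hI, A, trim_id h hA, hwA⟩

theorem id_phat (h : IsTrimPartition S Y)
    (J : {J : Set P // IsIdeal S J}) (hJ : J ∈ Phat (idPO S)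
          (fun J : {J : Set P // IsIdeal S J} => {w : W | Iw S Y w = J.1})) :
    ∃ p : P, J = ⟨principalIdeal S p, principal_isIdeal S p⟩ := by
  obtain ⟨A, hA⟩ := hJ
  obtain ⟨w, hw, hwJ⟩ := trim_exists hA (po_refl _ J)
  have hwJ : Iw S Y w = J.1 := hwJ
  obtain ⟨C, ⟨r, hC⟩, hwC, hCA⟩ := h.2.1 w A (hA.2.1.mem_nhds hw)
  have hr : r ∈ J.1 := by rw [← hwJ]; exact ⟨C, hC, hwC⟩
  obtain ⟨y, hy, hyr⟩ := trim_exists hC (po_refl S r)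
  have hy2 : y ∈ (fun J : {J : Set P // IsIdeal S J} => {w : W | Iw S Y w = J.1})
      ⟨principalIdeal S r, principal_isIdeal S r⟩ := (Iw_principal_iff h y r).2 hyr
  have h1 := (id_le_iff _ _).1 (trim_mem_le hA (hCA hy) hy2)
  exact ⟨r, Subtype.ext (Subset.antisymm h1 fun q hq => J.2.2.1 r hr q hq)⟩

end Trim
section Rank
variable {W : Type*} [TopologicalSpace W] {Q : Type*} {S : POSystem Q} {Z : Q → Set W}
  {τ : W → Q}

theorem rank_label (h : IsRankPartition S Z) : ∃ τ : W → Q, ∀ x q, x ∈ Z q ↔ τ x = q := by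
  have h1 : ∀ x, ∃ q, x ∈ Z q := fun x => by
    have : x ∈ ⋃ q, Z q := by rw [h.2.1]; trivial
    exact mem_iUnion.1 this
  choose τ hτ using h1
  refine ⟨τ, fun x q => ⟨fun hx => ?_, fun hx => hx ▸ hτ x⟩⟩
  by_contra hne
  exact Set.disjoint_left.1 (h.1.2.1 hne) (hτ x) hx

theorem rank_limit (h : IsRankPartition S Z) (hτ : ∀ x q, x ∈ Z q ↔ τ x = q) (x : W) (p : Q) :
    x ∈ limitPts (Z p) ↔ S.lt (τ x) p := by
  have h1 := h.1.2.2 p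
  have h2 : (⋃ q, Z q) = univ := h.2.1
  rw [h2, inter_univ] at h1
  rw [h1]
  constructor
  · intro hx
    obtain ⟨q, hq, hxq⟩ := mem_iUnion₂.1 hx
    rw [(hτ x q).1 hxq]; exact hq
  · intro hx
    exact mem_iUnion₂.2 ⟨τ x, hx, (hτ x _).2 rfl⟩

theorem rank_closure (h : IsRankPartition S Z) (hτ : ∀ x q, x ∈ Z q ↔ τ x = q) (x : W) (p : Q) :
    x ∈ closure (Z p) ↔ S.le (τ x) p := by
  constructor
  · intro hx
    by_cases hxp : x ∈ Z p
    · exact Or.inr ((hτ x p).1 hxp)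
    · left
      rw [← rank_limit h hτ]
      refine closure_mono ?_ hx
      intro y hy
      refine ⟨hy, ?_⟩
      rintro rfl
      exact hxp hy
  · rintro (hx | hx)
    · rw [← rank_limit h hτ] at hx
      exact closure_mono sdiff_subset hx
    · exact subset_closure ((hτ x p).2 hx)

theorem rank_open [SecondCountableTopology W] (h : IsRankPartition S Z)
    (hτ : ∀ x q, x ∈ Z q ↔ τ x = q) {q : Q} (hq : Separated S q) :
    IsOpen {x | S.le q (τ x)} := by
  rw [← isClosed_compl_iff]
  refine IsSeqClosed.isClosed fun u x hu hlim hx => ?_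
  have hx : S.le q (τ x) := hx
  have hu : ∀ n, ¬ S.le q (τ (u n)) := hu
  have hlimsub : ∀ g : ℕ ↪o ℕ, Tendsto (fun n => u (g n)) atTop (𝓝 x) := fun g =>
    hlim.comp g.strictMono.tendsto_atTop
  have : IsTrans Q S.le := ⟨fun _ _ _ => POSystem.le_trans⟩
  have : IsTrans Q (fun a b => S.le b a) := ⟨fun _ _ _ h1 h2 => POSystem.le_trans h2 h1⟩
  obtain ⟨g, hg | hg⟩ := exists_increasing_or_nonincreasing_subseq (fun a b => S.le b a)
    (fun n => τ (u n))
  · have : x ∈ closure (Z (τ (u (g 0)))) := by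
      refine isClosed_closure.mem_of_tendsto (hlimsub g) ?_
      filter_upwards [eventually_gt_atTop 0] with n hn
      rw [rank_closure h hτ]
      exact hg 0 n hn
    rw [rank_closure h hτ] at this
    exact hu _ (POSystem.le_trans hx this)
  · obtain ⟨g', hg'⟩ := exists_increasing_or_nonincreasing_subseq S.le
      (fun n => τ (u (g n)))
    have hinc : PairwiseIncompOrStrictIncr S (fun n => τ (u (g (g' n)))) := by
      rcases hg' with hg' | hg'
      · right
        intro j k hjk
        have h1 := hg' j k hjk
        have h2 := hg (g' j) (g' k) (g'.strictMono hjk)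
        rcases h1 with h1 | h1
        · refine ⟨h1, fun heq => h2 (Or.inr heq.symm)⟩
        · exact absurd (Or.inr h1.symm) h2
      · left
        intro j k hjk
        rcases lt_or_gt_of_ne hjk with hlt | hlt
        · exact hg' j k hlt
        · exact hg (g' k) (g' j) (g'.strictMono hlt)
    have := h.2.2.1 q hq x (fun n => u (g (g' n))) (τ x) (fun n => τ (u (g (g' n))))
      ((hτ _ _).2 rfl) (fun k => (hτ _ _).2 rfl)
      ((hlimsub g).comp g'.strictMono.tendsto_atTop)
      (fun k heq => hu _ (by rw [heq]; exact hx)) hx hinc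
    obtain ⟨k, hk⟩ := this.exists
    exact hu _ hk

theorem rank_isolate (h : IsRankPartition S Z) (hτ : ∀ x q, x ∈ Z q ↔ τ x = q) {q : Q} (w : W)
    (hw : S.le q (τ w)) :
    ∃ N ∈ 𝓝 w, ¬ S.lt q q → ∀ z ∈ N, z ∈ Z q → z = w := by
  by_cases hq : S.lt q q
  · exact ⟨univ, univ_mem, fun hn => absurd hq hn⟩
  · have : w ∉ limitPts (Z q) := by
      rw [rank_limit h hτ]
      intro hlt
      have := po_antisymm S hw (Or.inl hlt)
      rw [← this] at hlt
      exact hq hlt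
    refine ⟨(Z q \ {w})ᶜ, ?_, fun _ z hz hzq => ?_⟩
    · have h2 : (closure (Z q \ {w}))ᶜ ∈ 𝓝 w := isClosed_closure.isOpen_compl.mem_nhds this
      exact mem_of_superset h2 (compl_subset_compl.2 subset_closure)
    · by_contra hne
      exact hz ⟨hzq, hne⟩

section
variable [SecondCountableTopology W] [LocallyCompactSpace W] [T2Space W]
  [TotallyDisconnectedSpace W]

theorem rank_trim_build (h : IsRankPartition S Z) (hτ : ∀ x q, x ∈ Z q ↔ τ x = q) {q : Q}
    (hq : Separated S q) {w : W} (hw : S.le q (τ w)) {U : Set W} (hU : IsOpen U) (hwU : w ∈ U)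
    (hy : ∃ y ∈ U, τ y = q) : ∃ C, IsTrimAt S Z C q ∧ w ∈ C ∧ C ⊆ U := by
  have hy : ∃ y ∈ U, τ y = q ∧ (τ w = q → w = y) := by
    by_cases hwq : τ w = q
    · exact ⟨w, hwU, hwq, fun _ => rfl⟩
    · obtain ⟨y, hyU, hyq⟩ := hy
      exact ⟨y, hyU, hyq, fun hn => absurd hn hwq⟩
  obtain ⟨y, hyU, hyq, hwy⟩ := hy
  have hqy : S.le q (τ y) := Or.inr hyq.symm
  obtain ⟨N, hN, hN'⟩ := rank_isolate h hτ w hw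
  obtain ⟨M, hM, hM'⟩ := rank_isolate h hτ y hqy
  have hV := rank_open h hτ hq
  obtain ⟨C, hC, hCo, hwC, hCs⟩ := compOpen_basis w (U ∩ {x | S.le q (τ x)} ∩ N)
    (inter_mem ((hU.inter hV).mem_nhds ⟨hwU, hw⟩) hN)
  obtain ⟨D, hD, hDo, hyD, hDs⟩ := compOpen_basis y (U ∩ {x | S.le q (τ x)} ∩ M)
    (inter_mem ((hU.inter hV).mem_nhds ⟨hyU, hqy⟩) hM)
  refine ⟨C ∪ D, ⟨hC.union hD, hCo.union hDo, ?_, fun hd => ?_⟩, Or.inl hwC,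
    union_subset (fun z hz => (hCs hz).1.1) (fun z hz => (hDs hz).1.1)⟩
  · ext r
    constructor
    · rintro ⟨z, hz | hz, hzr⟩
      · have h1 : S.le q (τ z) := (hCs hz).1.2
        rw [(hτ z r).1 hzr] at h1
        exact h1
      · have h1 : S.le q (τ z) := (hDs hz).1.2
        rw [(hτ z r).1 hzr] at h1
        exact h1
    · intro hr
      have hr : S.le q r := hr
      have : y ∈ closure (Z r) := by rw [rank_closure h hτ, hyq]; exact hr
      exact mem_closure_iff.1 this _ (hCo.union hDo) (Or.inr hyD)
  · refine ⟨y, ⟨Or.inr hyD, (hτ y q).2 hyq⟩, ?_⟩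
    rintro z ⟨hz | hz, hzq⟩
    · have h1 := hN' hd z (hCs hz).2 hzq
      subst h1
      exact hwy ((hτ z q).1 hzq)
    · exact hM' hd z (hDs hz).2 hzq

theorem rank_min (h : IsRankPartition S Z) (hτ : ∀ x q, x ∈ Z q ↔ τ x = q) {A : Set W}
    (hA : IsCompact A) {x : W} (hx : x ∈ A) :
    ∃ y ∈ A, S.le (τ y) (τ x) ∧ ∀ z ∈ A, S.le (τ z) (τ y) → τ z = τ y := by
  obtain ⟨⟨y, hyA, hyx⟩, hy⟩ := exists_maximal_of_chains_bounded
    (α := {y // y ∈ A ∧ S.le (τ y) (τ x)}) (r := fun a b => S.le (τ b.1) (τ a.1)) (by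
      intro c hc
      by_cases hne : c.Nonempty
      · have : Nonempty c := hne.to_subtype
        obtain ⟨w, hw⟩ := IsCompact.nonempty_iInter_of_directed_nonempty_isCompact_isClosed
          (fun a : c => A ∩ closure (Z (τ a.1.1))) (by
            have key : ∀ a b : c, S.le (τ a.1.1) (τ b.1.1) →
                A ∩ closure (Z (τ a.1.1)) ⊆ A ∩ closure (Z (τ b.1.1)) := by
              rintro a b hab z ⟨hz, hz'⟩
              refine ⟨hz, ?_⟩
              rw [rank_closure h hτ] at hz' ⊢
              exact POSystem.le_trans hz' hab
            intro a b
            rcases eq_or_ne a.1 b.1 with heq | hab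
            · exact ⟨a, Subset.rfl, key a b (by rw [heq]; exact po_refl S _)⟩
            · rcases hc a.2 b.2 hab with hab | hab
              · exact ⟨b, key b a hab, Subset.rfl⟩
              · exact ⟨a, Subset.rfl, key a b hab⟩)
          (fun a => ⟨a.1.1, a.1.2.1, subset_closure ((hτ _ _).2 rfl)⟩)
          (fun a => hA.inter_right isClosed_closure)
          (fun a => hA.isClosed.inter isClosed_closure)
        rw [mem_iInter] at hw
        have hw' : ∀ a : c, S.le (τ w) (τ a.1.1) := fun a =>
          (rank_closure h hτ _ _).1 (hw a).2
        obtain ⟨a, ha⟩ := hne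
        exact ⟨⟨w, (hw ⟨a, ha⟩).1, POSystem.le_trans (hw' ⟨a, ha⟩) a.2.2⟩,
          fun b hb => hw' ⟨b, hb⟩⟩
      · exact ⟨⟨x, hx, po_refl S _⟩, fun a ha => absurd ⟨a, ha⟩ hne⟩)
    (fun h1 h2 => POSystem.le_trans h2 h1)
  refine ⟨y, hyA, hyx, fun z hz hzy => ?_⟩
  exact po_antisymm S hzy (hy ⟨z, hz, POSystem.le_trans hzy hyx⟩ hzy)

theorem rank_near_sep (h : IsRankPartition S Z) (hτ : ∀ x q, x ∈ Z q ↔ τ x = q) {x : W}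
    {U : Set W} (hU : U ∈ 𝓝 x) : ∃ y ∈ U, S.le (τ y) (τ x) ∧ Separated S (τ y) := by
  obtain ⟨A, hA, hAo, hxA, hAU⟩ := compOpen_basis x U hU
  obtain ⟨y, hy, hyx, hmin⟩ := rank_min h hτ hA hxA
  refine ⟨y, hAU hy, hyx, ?_⟩
  by_contra hns
  obtain ⟨u, hu, hu'⟩ := h.2.2.2 y (τ y) ((hτ _ _).2 rfl) hns
  obtain ⟨k, hk⟩ := (hu.eventually (hAo.mem_nhds hy)).exists
  obtain ⟨q, hq, hlt, hne⟩ := hu' k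
  rw [← (hτ _ _).1 hq] at hlt hne
  exact hne (hmin _ hk (Or.inl hlt))

theorem rank_T1 (h : IsRankPartition S Z) (hτ : ∀ x q, x ∈ Z q ↔ τ x = q) {x : W}
    {U : Set W} (hU : U ∈ 𝓝 x) : ∃ A p, IsTrimAt S Z A p ∧ x ∈ A ∧ A ⊆ U := by
  obtain ⟨V, hVU, hV, hxV⟩ := mem_nhds_iff.1 hU
  obtain ⟨y, hy, hyx, hs⟩ := rank_near_sep h hτ (hV.mem_nhds hxV)
  obtain ⟨C, hC, hxC, hCV⟩ := rank_trim_build h hτ hs hyx hV hxV ⟨y, hy, rfl⟩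
  exact ⟨C, _, hC, hxC, hCV.trans hVU⟩

theorem rank_sep_trim (h : IsRankPartition S Z) (hτ : ∀ x q, x ∈ Z q ↔ τ x = q) {x : W} {q : Q}
    (hq : Separated S q) (hx : S.le q (τ x)) : ∃ A, IsTrimAt S Z A q ∧ x ∈ A := by
  obtain ⟨y, hy⟩ := h.1.1 q
  obtain ⟨A, hA, hxA, _⟩ := rank_trim_build h hτ hq hx isOpen_univ trivial
    ⟨y, trivial, (hτ _ _).1 hy⟩
  exact ⟨A, hA, hxA⟩

theorem rank_phat (h : IsRankPartition S Z) (hτ : ∀ x q, x ∈ Z q ↔ τ x = q) (q : Q) :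
    q ∈ Phat S Z ↔ Separated S q := by
  constructor
  · rintro ⟨A, hA⟩
    by_contra hns
    obtain ⟨x, hx, hxq⟩ := trim_exists hA (po_refl S q)
    obtain ⟨u, hu, hu'⟩ := h.2.2.2 x q hxq hns
    obtain ⟨k, hk⟩ := (hu.eventually (hA.2.1.mem_nhds hx)).exists
    obtain ⟨r, hr, hlt, hne⟩ := hu' k
    exact hne (po_antisymm S (Or.inl hlt) (trim_mem_le hA hk hr))
  · intro hq
    obtain ⟨y, hy⟩ := h.1.1 q
    obtain ⟨A, hA, _⟩ := rank_sep_trim h hτ (x := y) hq (Or.inr ((hτ _ _).1 hy).symm)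
    exact ⟨A, hA⟩

theorem rank_clean_eq (h : IsRankPartition S Z) :
    (fun q : ↥(Phat S Z) => {w : W | w ∈ Z q.1 ∧ ∃ A, IsTrimAt S Z A q.1 ∧ w ∈ A}) =
      fun q : ↥(Phat S Z) => Z q.1 := by
  obtain ⟨τ, hτ⟩ := rank_label h
  funext q
  ext w
  refine ⟨fun hw => hw.1, fun hw => ⟨hw, ?_⟩⟩
  exact rank_sep_trim h hτ ((rank_phat h hτ _).1 q.2) (Or.inr ((hτ _ _).1 hw).symm)

theorem restrict_le {T : Set Q} (a b : T) : (restrictPO S T).le a b ↔ S.le a.1 b.1 := by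
  constructor
  · rintro (h | h)
    · exact Or.inl h
    · exact Or.inr (congrArg Subtype.val h)
  · rintro (h | h)
    · exact Or.inl h
    · exact Or.inr (Subtype.ext h)

theorem rank_trim_iff (h : IsRankPartition S Z) (hτ : ∀ x q, x ∈ Z q ↔ τ x = q)
    (A : Set W) (p : ↥(Phat S Z)) :
    IsTrimAt (restrictPO S (Phat S Z)) (fun q : ↥(Phat S Z) => Z q.1) A p ↔
      IsTrimAt S Z A p.1 := by
  constructor
  · intro hA
    refine ⟨hA.1, hA.2.1, ?_, hA.2.2.2⟩
    ext r
    constructor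
    · rintro ⟨y, hy, hyr⟩
      obtain ⟨C, s, hC, hyC, hCA⟩ := rank_T1 h hτ (hA.2.1.mem_nhds hy)
      obtain ⟨z, hz, hzs⟩ := trim_exists hC (po_refl S s)
      have h1 := (restrict_le _ _).1 (trim_mem_le (q := ⟨s, C, hC⟩) hA (hCA hz) hzs)
      exact POSystem.le_trans h1 (trim_mem_le hC hyC hyr)
    · intro hr
      have hr : S.le p.1 r := hr
      obtain ⟨y, hy, hyp⟩ := trim_exists hA (po_refl _ p)
      have : y ∈ closure (Z r) := by
        rw [rank_closure h hτ, (hτ _ _).1 hyp]; exact hr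
      exact mem_closure_iff.1 this A hA.2.1 hy
  · intro hA
    refine ⟨hA.1, hA.2.1, ?_, hA.2.2.2⟩
    ext r
    constructor
    · rintro ⟨y, hy, hyr⟩
      exact (restrict_le _ _).2 (trim_mem_le hA hy hyr)
    · intro hr
      obtain ⟨y, hy, hyr⟩ := trim_exists hA ((restrict_le _ _).1 hr)
      exact ⟨y, hy, hyr⟩

theorem rank_trim (h : IsRankPartition S Z) :
    IsTrimPartition (restrictPO S (Phat S Z)) (fun q : ↥(Phat S Z) => Z q.1) := by
  obtain ⟨τ, hτ⟩ := rank_label h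
  refine ⟨⟨fun p => h.1.1 p.1, fun p q hpq => h.1.2.1 fun he => hpq (Subtype.ext he), ?_⟩,
    ?_, ?_, ?_⟩
  · intro p
    ext x
    constructor
    · rintro ⟨hx, hx'⟩
      obtain ⟨q, hq⟩ := mem_iUnion.1 hx'
      refine mem_iUnion₂.2 ⟨q, ?_, hq⟩
      have := (rank_limit h hτ _ _).1 hx
      rw [(hτ _ _).1 hq] at this
      exact this
    · intro hx
      obtain ⟨q, hqp, hxq⟩ := mem_iUnion₂.1 hx
      refine ⟨(rank_limit h hτ _ _).2 ?_, mem_iUnion.2 ⟨q, hxq⟩⟩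
      rw [(hτ _ _).1 hxq]
      exact hqp
  · intro w U hU
    obtain ⟨A, p, hA, hw, hAU⟩ := rank_T1 h hτ hU
    exact ⟨A, ⟨⟨p, A, hA⟩, (rank_trim_iff h hτ A ⟨p, A, hA⟩).2 hA⟩, hw, hAU⟩
  · intro p _ w hw
    have h1 : w ∈ closure (Z p.1) := mem_closure_iff_nhds.2 fun U hU => by
      obtain ⟨A, hA, _, hAU⟩ := hw U hU
      obtain ⟨y, hy, hyp⟩ := trim_exists hA (po_refl _ p)
      exact ⟨y, hAU hy, hyp⟩
    obtain ⟨A, hA, hwA, _⟩ := hw univ univ_mem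
    have h2 := trim_mem_le ((rank_trim_iff h hτ A p).1 hA) hwA ((hτ w _).2 rfl)
    rw [rank_closure h hτ] at h1
    exact (hτ _ _).2 (po_antisymm S h1 h2)
  · intro p w hw
    obtain ⟨A, hA, hwA⟩ := rank_sep_trim h hτ ((rank_phat h hτ _).1 p.2)
      (Or.inr ((hτ _ _).1 hw).symm)
    exact ⟨A, (rank_trim_iff h hτ A p).2 hA, hwA⟩

theorem rank_Iw (h : IsRankPartition S Z) (hτ : ∀ x q, x ∈ Z q ↔ τ x = q) (w : W) :
    Iw (restrictPO S (Phat S Z)) (fun q : ↥(Phat S Z) => Z q.1) w = {p | S.le p.1 (τ w)} := by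
  ext p
  constructor
  · rintro ⟨A, hA, hw⟩
    exact trim_mem_le ((rank_trim_iff h hτ A p).1 hA) hw ((hτ w _).2 rfl)
  · intro hp
    obtain ⟨A, hA, hwA⟩ := rank_sep_trim h hτ ((rank_phat h hτ _).1 p.2) hp
    exact ⟨A, (rank_trim_iff h hτ A p).2 hA, hwA⟩

theorem rank_order (h : IsRankPartition S Z) (q r : Q) :
    {p : ↥(Phat S Z) | S.le p.1 q} ⊆ {p : ↥(Phat S Z) | S.le p.1 r} ↔ S.le q r := by
  obtain ⟨τ, hτ⟩ := rank_label h
  constructor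
  · intro hs
    obtain ⟨w, hw⟩ := h.1.1 q
    obtain rfl := (hτ _ _).1 hw
    rw [← rank_closure h hτ]
    refine mem_closure_iff_nhds.2 fun U hU => ?_
    obtain ⟨C, s, hC, hwC, hCU⟩ := rank_T1 h hτ hU
    have h1 : S.le s r := hs (a := ⟨s, C, hC⟩) (trim_mem_le hC hwC hw)
    obtain ⟨y, hy, hyr⟩ := trim_exists hC h1
    exact ⟨y, hCU hy, hyr⟩
  · intro hqr p hp
    exact POSystem.le_trans hp hqr

theorem rank_set_inj (h : IsRankPartition S Z) {q r : Q}
    (heq : {p : ↥(Phat S Z) | S.le p.1 q} = {p : ↥(Phat S Z) | S.le p.1 r}) : q = r :=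
  po_antisymm S ((rank_order h q r).1 heq.subset) ((rank_order h r q).1 heq.superset)

theorem rank_nonsep_lt (h : IsRankPartition S Z) {q : Q} (hq : ¬ Separated S q) : S.lt q q := by
  obtain ⟨τ, hτ⟩ := rank_label h
  obtain ⟨x, hx⟩ := h.1.1 q
  obtain ⟨u, hu, hu'⟩ := h.2.2.2 x q hx hq
  have : x ∈ limitPts (Z q) := by
    refine mem_closure_iff.2 fun U hU hxU => ?_
    obtain ⟨k, hk⟩ := (hu.eventually (hU.mem_nhds hxU)).exists
    obtain ⟨r, hr, hlt, hne⟩ := hu' k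
    have hy : u k ∈ closure (Z q) := by
      rw [rank_closure h hτ, (hτ _ _).1 hr]; exact Or.inl hlt
    have hyx : u k ≠ x := by
      intro he
      rw [he] at hr
      exact hne (((hτ _ _).1 hr).symm.trans ((hτ _ _).1 hx))
    obtain ⟨z, ⟨hzU, hzx⟩, hzq⟩ := mem_closure_iff.1 hy (U ∩ {x}ᶜ)
      (hU.inter isOpen_compl_singleton) ⟨hk, hyx⟩
    exact ⟨z, hzU, hzq, hzx⟩
  rw [rank_limit h hτ, (hτ _ _).1 hx] at this
  exact this

theorem rank_iso (h : IsRankPartition S Z) :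
    ∃ β : {J : Set ↥(Phat S Z) // IsIdeal (restrictPO S (Phat S Z)) J} → Q,
      IsIso (idPO (restrictPO S (Phat S Z))) S β ∧
      ∀ J, {w : W | Iw (restrictPO S (Phat S Z)) (fun q : ↥(Phat S Z) => Z q.1) w = J.1}
        = Z (β J) := by
  obtain ⟨τ, hτ⟩ := rank_label h
  have ht := rank_trim h
  have hex : ∀ J : {J : Set ↥(Phat S Z) // IsIdeal (restrictPO S (Phat S Z)) J},
      ∃ q, J.1 = {p : ↥(Phat S Z) | S.le p.1 q} := by
    intro J
    obtain ⟨w, hw⟩ := (id_ppartition ht).1 J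
    have hw : Iw (restrictPO S (Phat S Z)) (fun q : ↥(Phat S Z) => Z q.1) w = J.1 := hw
    exact ⟨τ w, by rw [← hw, rank_Iw h hτ]⟩
  choose β hβ using hex
  have hinj : Function.Injective β := fun J K hJK => by
    apply Subtype.ext
    rw [hβ J, hβ K, hJK]
  refine ⟨β, ⟨⟨hinj, fun q => ?_⟩, fun J K => ?_⟩, fun J => ?_⟩
  · obtain ⟨w, hw⟩ := h.1.1 q
    refine ⟨⟨_, Iw_ideal ht w⟩, ?_⟩
    apply rank_set_inj h
    rw [← hβ]
    show Iw _ _ w = _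
    rw [rank_Iw h hτ, (hτ _ _).1 hw]
  · by_cases hJK : J = K
    · subst hJK
      constructor
      · rintro (⟨_, hne⟩ | ⟨_, hn⟩)
        · exact absurd rfl hne
        · by_contra hd
          have hs : Separated S (β J) := by
            by_contra hns
            exact hd (rank_nonsep_lt h hns)
          refine hn ⟨⟨β J, (rank_phat h hτ _).2 hs⟩, hd, ?_⟩
          rw [hβ J]
          ext p
          exact (restrict_le p ⟨β J, (rank_phat h hτ _).2 hs⟩).symm
      · intro hlt
        refine Or.inr ⟨rfl, ?_⟩
        rintro ⟨p, hp, hJp⟩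
        have : β J = p.1 := by
          apply rank_set_inj h
          rw [← hβ J, hJp]
          ext r
          exact restrict_le _ _
        rw [this] at hlt
        exact hp hlt
    · have hne : β J ≠ β K := fun he => hJK (hinj he)
      have key : J.1 ⊆ K.1 ↔ S.le (β J) (β K) := by
        rw [hβ J, hβ K]; exact rank_order h _ _
      constructor
      · rintro (⟨hs, _⟩ | ⟨he, _⟩)
        · exact (key.1 hs).resolve_right hne
        · exact absurd he hJK
      · intro hlt
        exact Or.inl ⟨key.2 (Or.inl hlt), hJK⟩
  · ext w
    rw [hτ]
    show Iw _ _ w = _ ↔ _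
    rw [rank_Iw h hτ, hβ J]
    exact ⟨fun he => rank_set_inj h he, fun he => by rw [he]⟩

end
end Rank
end Helpers

/-- the maps `𝒴 ↦ id(𝒴)` (ideal completion) and `𝒵 ↦ 𝒵°` (clean interior)
are mutually inverse bijections between the trim partitions and the rank partitions of a
primitive ω-Stone space `W`; in particular the rank partitions of `W` are exactly the
ideal completions of trim partitions of `W`. -/
theorem trim_rank_bijection {W : Type u}
    [TopologicalSpace W] [SecondCountableTopology W] [LocallyCompactSpace W]
    [T2Space W] [TotallyDisconnectedSpace W]
    (hW : PrimitiveSpace W) :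
    -- the ideal completion of a trim partition is a rank partition whose clean
    -- interior is the original trim partition
    (∀ (P : Type u) (S : POSystem P) (Y : P → Set W), IsTrimPartition S Y →
      IsRankPartition (POSystem.idPO S)
        (fun J : {J : Set P // POSystem.IsIdeal S J} => {w : W | Iw S Y w = J.1}) ∧
      (∀ p : P,
        {w : W | Iw S Y w = POSystem.principalIdeal S p ∧
          IsCleanPt (POSystem.idPO S)
            (fun J : {J : Set P // POSystem.IsIdeal S J} => {w : W | Iw S Y w = J.1}) w}
          = Y p) ∧
      (∀ J ∈ Phat (POSystem.idPO S)
          (fun J : {J : Set P // POSystem.IsIdeal S J} => {w : W | Iw S Y w = J.1}),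
        ∃ p : P, J = ⟨POSystem.principalIdeal S p, POSystem.principal_isIdeal S p⟩)) ∧
    -- the clean interior of a rank partition is a trim partition (over `Q̂`), whose
    -- ideal completion is the original rank partition (up to relabelling)
    (∀ (Q : Type u) (SQ : POSystem Q) (Z : Q → Set W), IsRankPartition SQ Z →
      IsTrimPartition (POSystem.restrictPO SQ (Phat SQ Z))
        (fun q : ↥(Phat SQ Z) => {w : W | w ∈ Z q.1 ∧ ∃ A, IsTrimAt SQ Z A q.1 ∧ w ∈ A}) ∧
      ∃ β : {J : Set ↥(Phat SQ Z) //
          POSystem.IsIdeal (POSystem.restrictPO SQ (Phat SQ Z)) J} → Q,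
        POSystem.IsIso (POSystem.idPO (POSystem.restrictPO SQ (Phat SQ Z))) SQ β ∧
        ∀ J, {w : W | Iw (POSystem.restrictPO SQ (Phat SQ Z))
            (fun q : ↥(Phat SQ Z) =>
              {w : W | w ∈ Z q.1 ∧ ∃ A, IsTrimAt SQ Z A q.1 ∧ w ∈ A}) w = J.1}
          = Z (β J)) := by
  refine ⟨fun P S Y h => ⟨id_rank h, id_clean h, id_phat h⟩, fun Q SQ Z h => ?_⟩
  rw [rank_clean_eq h]
  exact ⟨rank_trim h, rank_iso h⟩
end
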